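/- In a triangulation of a closed surface that is not K4 on the sphere, an edge is noncontractible if and only if it is contained in at least three 3-cycles of the graph. -/

import Mathlib

open Finset

open scoped Classical

/-! Combinatorial model of triangulations of closed surfaces.
A triangulation is encoded by its finite set of triangular faces (3-element
vertex sets).  Surface-ness is expressed by: every edge lies in exactly two
faces, the link of every vertex is connected (hence a single cycle), and the
whole complex is connected. -/

variable {V : Type*} {W : Type*}

/-- Two faces are adjacent when they share an edge. -/
def FaceAdj [DecidableEq V] (faces : Finset (Finset V)) (A B : Finset V) : Prop :=
  A ∈ faces ∧ B ∈ faces ∧ (A ∩ B).card = 2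

/-- Two faces at a vertex `v` are adjacent when they share an edge through `v`. -/
def LinkAdj [DecidableEq V] (faces : Finset (Finset V)) (v : V) (A B : Finset V) : Prop :=
  A ∈ faces ∧ B ∈ faces ∧ v ∈ A ∩ B ∧ (A ∩ B).card = 2

/-- `faces` is the set of faces of a triangulation of a closed surface. -/
structure IsTriangulation [DecidableEq V] (faces : Finset (Finset V)) : Prop where
  nonempty : faces.Nonempty
  card_three : ∀ F ∈ faces, F.card = 3
  edge_two_faces : ∀ e : Finset V, e.card = 2 → (∃ F ∈ faces, e ⊆ F) →
    (faces.filter fun F => e ⊆ F).card = 2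
  link_connected : ∀ v : V, ∀ F ∈ faces, ∀ G ∈ faces, v ∈ F → v ∈ G →
    Relation.ReflTransGen (LinkAdj faces v) F G
  connected : ∀ F ∈ faces, ∀ G ∈ faces, Relation.ReflTransGen (FaceAdj faces) F G

/-- The vertices of a triangulation. -/
def vertexSet [DecidableEq V] (faces : Finset (Finset V)) : Finset V :=
  faces.biUnion id

/-- The edges of a triangulation: the 2-element subsets of faces. -/
noncomputable def edgeSet [DecidableEq V] (faces : Finset (Finset V)) : Finset (Finset V) :=
  ((vertexSet faces).powersetCard 2).filter fun e => ∃ F ∈ faces, e ⊆ F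

/-- Euler characteristic `n - e + f`. -/
noncomputable def eulerChar [DecidableEq V] (faces : Finset (Finset V)) : ℤ :=
  ((vertexSet faces).card : ℤ) - ((edgeSet faces).card : ℤ) + (faces.card : ℤ)

/-- Euler genus `2 - χ`. -/
noncomputable def eulerGenus [DecidableEq V] (faces : Finset (Finset V)) : ℤ :=
  2 - eulerChar faces

/-- The degree of a vertex. -/
noncomputable def degree [DecidableEq V] (faces : Finset (Finset V)) (v : V) : ℕ :=
  ((edgeSet faces).filter fun e => v ∈ e).card

/-- Adjacency of vertices in a triangulation. -/
def Adj [DecidableEq V] (faces : Finset (Finset V)) (a b : V) : Prop :=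
  a ≠ b ∧ ∃ F ∈ faces, ({a, b} : Finset V) ⊆ F

/-- A 3-cycle of the graph of the triangulation: three pairwise adjacent vertices. -/
noncomputable def IsTriCycle [DecidableEq V] (faces : Finset (Finset V)) (C : Finset V) : Prop :=
  C.card = 3 ∧ ∀ e ∈ C.powersetCard 2, e ∈ edgeSet faces

/-- A nonfacial 3-cycle: a 3-cycle which does not bound a face. -/
noncomputable def IsNonfacialTriCycle [DecidableEq V] (faces : Finset (Finset V))
    (C : Finset V) : Prop :=
  IsTriCycle faces C ∧ C ∉ faces

/-- The number of 3-cycles containing a given edge (= common neighbours of its ends). -/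
noncomputable def numTriCyclesOn [DecidableEq V] (faces : Finset (Finset V))
    (e : Finset V) : ℕ :=
  ((vertexSet faces).filter fun x => x ∉ e ∧ ∀ y ∈ e, Adj faces x y).card

/-- Contraction of the edge `ac` (the vertex `c` is identified with `a`,
the two faces containing `ac` collapse, multiple edges/faces merge). -/
def contract [DecidableEq V] (faces : Finset (Finset V)) (a c : V) : Finset (Finset V) :=
  (faces.filter fun F => ¬ (a ∈ F ∧ c ∈ F)).image
    (Finset.image fun x => if x = c then a else x)

/-- A coherent cyclic orientation of one triangular face, given as the set of its three
directed edges. -/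
def IsCyclicOrientation [DecidableEq V] (F : Finset V) (d : Finset (V × V)) : Prop :=
  d.card = 3 ∧ (∀ p ∈ d, p.1 ∈ F ∧ p.2 ∈ F ∧ p.1 ≠ p.2) ∧
  (∀ x ∈ F, (d.filter fun p => p.1 = x).card = 1 ∧ (d.filter fun p => p.2 = x).card = 1)

/-- Orientability: the faces can be coherently oriented (each directed edge is used
by at most one oriented face). -/
def Orientable [DecidableEq V] (faces : Finset (Finset V)) : Prop :=
  ∃ or : Finset V → Finset (V × V),
    (∀ F ∈ faces, IsCyclicOrientation F (or F)) ∧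
    (∀ F ∈ faces, ∀ G ∈ faces, F ≠ G → ∀ p ∈ or F, p ∉ or G)

/-- Two (connected, closed) triangulated surfaces are the same surface iff they have the
same Euler characteristic and the same orientability. -/
noncomputable def SameSurface [DecidableEq V] (f₁ f₂ : Finset (Finset V)) : Prop :=
  eulerChar f₁ = eulerChar f₂ ∧ (Orientable f₁ ↔ Orientable f₂)

/-- The edge `ac` is contractible: contracting it yields again a triangulation
of the same surface. -/
noncomputable def Contractible [DecidableEq V] (faces : Finset (Finset V)) (a c : V) : Prop :=
  ({a, c} : Finset V) ∈ edgeSet faces ∧ IsTriangulation (contract faces a c) ∧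
    SameSurface (contract faces a c) faces

/-- An edge (as a 2-element set) is contractible. -/
noncomputable def ContractibleEdge [DecidableEq V] (faces : Finset (Finset V))
    (e : Finset V) : Prop :=
  ∃ a c : V, e = ({a, c} : Finset V) ∧ Contractible faces a c

/-- An irreducible triangulation: no edge is contractible. -/
noncomputable def IrreducibleTri [DecidableEq V] (faces : Finset (Finset V)) : Prop :=
  IsTriangulation faces ∧ ∀ e ∈ edgeSet faces, ¬ ContractibleEdge faces e

/-- Face adjacency avoiding the edges of the cycle with vertex set `C`. -/
def SeparatesRel [DecidableEq V] (faces : Finset (Finset V)) (C : Finset V)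
    (A B : Finset V) : Prop :=
  A ∈ faces ∧ B ∈ faces ∧ (A ∩ B).card = 2 ∧ ¬ (A ∩ B ⊆ C)

/-- A cycle with vertex set `C` is nonseparating iff the complement of the embedded
curve is connected, i.e. any two faces are joined by a path of faces never crossing
an edge of the cycle. -/
def Nonseparating [DecidableEq V] (faces : Finset (Finset V)) (C : Finset V) : Prop :=
  ∀ A ∈ faces, ∀ B ∈ faces, Relation.ReflTransGen (SeparatesRel faces C) A B

/-- A corner of the cycle `C`: a vertex of `C` together with a face containing it. -/
def Corner [DecidableEq V] (faces : Finset (Finset V)) (C : Finset V)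
    (p : V × Finset V) : Prop :=
  p.1 ∈ C ∧ p.2 ∈ faces ∧ p.1 ∈ p.2

/-- Adjacency of corners of `C`: move inside a link avoiding the cycle, or move along
a face containing an edge of the cycle.  The connected components of this relation
are the boundary curves of a regular neighbourhood of the cycle. -/
def CornerRel [DecidableEq V] (faces : Finset (Finset V)) (C : Finset V)
    (p q : V × Finset V) : Prop :=
  Corner faces C p ∧ Corner faces C q ∧
    ((p.1 = q.1 ∧ (p.2 ∩ q.2).card = 2 ∧ p.1 ∈ p.2 ∩ q.2 ∧ ¬ (p.2 ∩ q.2 ⊆ C)) ∨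
     (p.2 = q.2 ∧ p.1 ≠ q.1))

/-- A cycle is one-sided iff a regular neighbourhood of it is a Möbius band, i.e. the
neighbourhood has a single boundary curve: all corners are connected. -/
def OneSided [DecidableEq V] (faces : Finset (Finset V)) (C : Finset V) : Prop :=
  ∀ p q, Corner faces C p → Corner faces C q →
    Relation.ReflTransGen (CornerRel faces C) p q

/-- `ℓ` enumerates the link of `a` cyclically: the faces at `a` are exactly the
triangles `a ℓᵢ ℓᵢ₊₁`. -/
def IsLink [DecidableEq V] (faces : Finset (Finset V)) (a : V) (d : ℕ)
    (ℓ : ZMod d → V) : Prop :=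
  Function.Injective ℓ ∧ (∀ i, ℓ i ≠ a) ∧
    ∀ F : Finset V, (F ∈ faces ∧ a ∈ F) ↔ ∃ i : ZMod d, F = {a, ℓ i, ℓ (i + 1)}

/-- Splitting the vertex `a` along `ℓ₀ a ℓₛ₋₁` (paper's `v₁ a vₛ`): the vertex `a`
becomes the two vertices `a₁ = Sum.inl a` and `a₂ = Sum.inr ()`. -/
noncomputable def splitFaces [DecidableEq V] (faces : Finset (Finset V)) (a : V) {d : ℕ}
    (ℓ : ZMod d → V) (s : ℕ) : Finset (Finset (V ⊕ Unit)) :=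
  ((faces.filter fun F => a ∉ F).image (Finset.image Sum.inl)) ∪
  ((Finset.range (s - 1)).image fun i =>
    ({Sum.inl a, Sum.inl (ℓ (i : ZMod d)), Sum.inl (ℓ ((i : ZMod d) + 1))} :
      Finset (V ⊕ Unit))) ∪
  ((Finset.Ico (s - 1) d).image fun i =>
    ({Sum.inr (), Sum.inl (ℓ (i : ZMod d)), Sum.inl (ℓ ((i : ZMod d) + 1))} :
      Finset (V ⊕ Unit))) ∪
  {({Sum.inl a, Sum.inr (), Sum.inl (ℓ (0 : ZMod d))} : Finset (V ⊕ Unit)),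
   ({Sum.inl a, Sum.inr (), Sum.inl (ℓ ((s - 1 : ℕ) : ZMod d))} : Finset (V ⊕ Unit))}

/-- Renaming of vertices when cutting along a two-sided 3-cycle `w₀w₁w₂`:
faces with `side = true` keep the original vertices, faces with `side = false`
get the new copies `Sum.inr i`. -/
noncomputable def renameTwoSided [DecidableEq V] (w : Fin 3 → V) (s : Bool) (x : V) : V ⊕ Fin 3 :=
  if x = w 0 then (if s then Sum.inl x else Sum.inr 0)
  else if x = w 1 then (if s then Sum.inl x else Sum.inr 1)
  else if x = w 2 then (if s then Sum.inl x else Sum.inr 2)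
  else Sum.inl x

/-- A coherent side assignment for cutting along the two-sided 3-cycle with vertex
set `C`: constant along link arcs avoiding the cycle, and the two faces on an edge
of the cycle lie on opposite sides. -/
def CoherentSide [DecidableEq V] (faces : Finset (Finset V)) (C : Finset V)
    (side : Finset V → Bool) : Prop :=
  (∀ F ∈ faces, ∀ G ∈ faces, (F ∩ G).card = 2 → ((F ∩ G) ∩ C).Nonempty →
      ¬ (F ∩ G ⊆ C) → side F = side G) ∧
  (∀ F ∈ faces, ∀ G ∈ faces, F ≠ G → (F ∩ G).card = 2 → F ∩ G ⊆ C → side F ≠ side G)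

/-- Cut along a two-sided 3-cycle and cap the two resulting boundary 3-cycles
with two new triangular faces. -/
noncomputable def cutCapTwoSided [DecidableEq V] (faces : Finset (Finset V)) (w : Fin 3 → V)
    (side : Finset V → Bool) : Finset (Finset (V ⊕ Fin 3)) :=
  (faces.image fun F => F.image (renameTwoSided w (side F))) ∪
  {({Sum.inl (w 0), Sum.inl (w 1), Sum.inl (w 2)} : Finset (V ⊕ Fin 3)),
   ({Sum.inr 0, Sum.inr 1, Sum.inr 2} : Finset (V ⊕ Fin 3))}

/-- The six edges of the boundary hexagon `u₁u₂u₃v₁v₂v₃` produced by cutting along a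
one-sided 3-cycle; `(i, true)` is `uᵢ₊₁` and `(i, false)` is `vᵢ₊₁`. -/
def hexEdges : Finset (Finset (Fin 3 × Bool)) :=
  { ({(0, true), (1, true)} : Finset (Fin 3 × Bool)),
    ({(1, true), (2, true)} : Finset (Fin 3 × Bool)),
    ({(2, true), (0, false)} : Finset (Fin 3 × Bool)),
    ({(0, false), (1, false)} : Finset (Fin 3 × Bool)),
    ({(1, false), (2, false)} : Finset (Fin 3 × Bool)),
    ({(2, false), (0, true)} : Finset (Fin 3 × Bool)) }

/-- Renaming of vertices when cutting along a one-sided 3-cycle: the vertex `w i` of a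
face becomes the copy `(i, σ i)` on the boundary hexagon. -/
noncomputable def renameOneSided [DecidableEq V] (w : Fin 3 → V) (σ : Fin 3 → Bool) (x : V) :
    V ⊕ (Fin 3 × Bool) ⊕ Unit :=
  if x = w 0 then Sum.inr (Sum.inl (0, σ 0))
  else if x = w 1 then Sum.inr (Sum.inl (1, σ 1))
  else if x = w 2 then Sum.inr (Sum.inl (2, σ 2))
  else Sum.inl x

/-- Coherence of the corner assignment `σ` for cutting along a one-sided 3-cycle
`w₀w₁w₂`: constant along link arcs avoiding the cycle, each face on an edge of the
cycle produces an edge of the boundary hexagon, and each hexagon edge is produced by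
exactly one face. -/
noncomputable def CoherentOneSided [DecidableEq V] (faces : Finset (Finset V)) (w : Fin 3 → V)
    (σ : Finset V → Fin 3 → Bool) : Prop :=
  (∀ F ∈ faces, ∀ G ∈ faces, ∀ i : Fin 3, (F ∩ G).card = 2 → w i ∈ F ∩ G →
      ¬ (F ∩ G ⊆ ({w 0, w 1, w 2} : Finset V)) → σ F i = σ G i) ∧
  (∀ F ∈ faces, ∀ i j : Fin 3, i ≠ j → ({w i, w j} : Finset V) ⊆ F →
      ({(i, σ F i), (j, σ F j)} : Finset (Fin 3 × Bool)) ∈ hexEdges) ∧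
  (∀ h ∈ hexEdges,
    (faces.filter fun F => ∃ i j : Fin 3, i ≠ j ∧ ({w i, w j} : Finset V) ⊆ F ∧
      ({(i, σ F i), (j, σ F j)} : Finset (Fin 3 × Bool)) = h).card = 1)

/-- Cut along a one-sided 3-cycle and cap the resulting boundary hexagon with a new
vertex `t' = Sum.inr (Sum.inr ())` joined to the six boundary vertices. -/
noncomputable def cutCapOneSided [DecidableEq V] (faces : Finset (Finset V)) (w : Fin 3 → V)
    (σ : Finset V → Fin 3 → Bool) : Finset (Finset (V ⊕ (Fin 3 × Bool) ⊕ Unit)) :=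
  (faces.image fun F => F.image (renameOneSided w (σ F))) ∪
  (hexEdges.image fun h =>
    insert (Sum.inr (Sum.inr ()))
      (h.image fun p => (Sum.inr (Sum.inl p) : V ⊕ (Fin 3 × Bool) ⊕ Unit)))

/-- Adding a handle: remove the faces `abc` and `def` and identify `d ↦ a`, `e ↦ b`,
`f ↦ c`. -/
noncomputable def glueHandle [DecidableEq V] (faces : Finset (Finset V)) (a b c d e f : V) :
    Finset (Finset V) :=
  ((faces \ {({a, b, c} : Finset V), ({d, e, f} : Finset V)}).image
    (Finset.image fun x => if x = d then a else if x = e then b else if x = f then c else x))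

/-- Adding a crosscap at a degree six vertex `t` with link `ℓ₀ … ℓ₅`: remove `t` with
its incident edges and faces and identify opposite vertices of the hexagonal hole. -/
noncomputable def addCrosscap [DecidableEq V] (faces : Finset (Finset V)) (t : V) (ℓ : ZMod 6 → V) :
    Finset (Finset V) :=
  (faces.filter fun F => t ∉ F).image
    (Finset.image fun x =>
      if x = ℓ 3 then ℓ 0 else if x = ℓ 4 then ℓ 1 else if x = ℓ 5 then ℓ 2 else x)

/-- Connected sum of two triangulations along the faces `abc` and `def`. -/
noncomputable def glueSum [DecidableEq V] [DecidableEq W] (f₁ : Finset (Finset V))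
    (f₂ : Finset (Finset W)) (a b c : V) (d e f : W) : Finset (Finset (V ⊕ W)) :=
  ((f₁.erase {a, b, c}).image (Finset.image Sum.inl)) ∪
  ((f₂.erase {d, e, f}).image (Finset.image fun y =>
    if y = d then Sum.inl a else if y = e then Sum.inl b
    else if y = f then Sum.inl c else (Sum.inr y : V ⊕ W)))

/-- The vertex identification used by `contract`. -/
def rho [DecidableEq V] (a c : V) : V → V := fun x => if x = c then a else x

lemma mem_contract' [DecidableEq V] {faces : Finset (Finset V)} {a c : V} {A : Finset V} :
    A ∈ contract faces a c ↔ ∃ F ∈ faces, ¬ (a ∈ F ∧ c ∈ F) ∧ F.image (rho a c) = A := by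
  unfold contract rho
  simp only [Finset.mem_image, Finset.mem_filter, and_assoc]

lemma mem_img [DecidableEq V] {a c : V} (hac : a ≠ c) (F : Finset V) (x : V) :
    x ∈ F.image (rho a c) ↔ (x ≠ c ∧ x ∈ F) ∨ (x = a ∧ c ∈ F) := by
  simp only [Finset.mem_image, rho]
  constructor
  · rintro ⟨y, hy, h⟩
    split_ifs at h with h1
    · subst h1; right; exact ⟨h.symm, hy⟩
    · subst h; left; exact ⟨h1, hy⟩
  · rintro (⟨h1, h2⟩ | ⟨h1, h2⟩)
    · exact ⟨x, h2, by simp [h1]⟩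
    · exact ⟨c, h2, by simp [h1]⟩

lemma rho_injOn [DecidableEq V] {a c : V} {F : Finset V} (hF : ¬ (a ∈ F ∧ c ∈ F)) :
    ∀ x ∈ F, ∀ y ∈ F, rho a c x = rho a c y → x = y := by
  intro x hx y hy h
  unfold rho at h
  split_ifs at h <;> grind

lemma card_img [DecidableEq V] {a c : V} {F : Finset V} (hF : ¬ (a ∈ F ∧ c ∈ F)) :
    (F.image (rho a c)).card = F.card :=
  Finset.card_image_of_injOn (fun x hx y hy h => rho_injOn hF x hx y hy h)

/-- Any third face through an edge of two given distinct faces is one of them. -/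
lemma IsTriangulation.two_eq [DecidableEq V] {faces : Finset (Finset V)}
    (h : IsTriangulation faces) {u v : V} (huv : u ≠ v) {A B H : Finset V}
    (hA : A ∈ faces) (hB : B ∈ faces) (hH : H ∈ faces) (hAB : A ≠ B)
    (uA : u ∈ A) (vA : v ∈ A) (uB : u ∈ B) (vB : v ∈ B) (uH : u ∈ H) (vH : v ∈ H) :
    H = A ∨ H = B := by
  have h2 := h.edge_two_faces {u, v} (Finset.card_pair huv) ⟨A, hA, by grind⟩
  have : ({A, B} : Finset (Finset V)) = faces.filter fun F => ({u, v} : Finset V) ⊆ F := by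
    apply Finset.eq_of_subset_of_card_le
    · intro X hX
      simp only [Finset.mem_insert, Finset.mem_singleton] at hX
      simp only [Finset.mem_filter]
      rcases hX with rfl | rfl
      · exact ⟨hA, by grind⟩
      · exact ⟨hB, by grind⟩
    · rw [h2, Finset.card_pair hAB]
  have hm : H ∈ faces.filter fun F => ({u, v} : Finset V) ⊆ F := by
    simp only [Finset.mem_filter]
    exact ⟨hH, by grind⟩
  rw [← this] at hm
  simpa using hm

/-- The second face through an edge. -/
lemma IsTriangulation.other [DecidableEq V] {faces : Finset (Finset V)}
    (h : IsTriangulation faces) {u v : V} (huv : u ≠ v) {A : Finset V}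
    (hA : A ∈ faces) (uA : u ∈ A) (vA : v ∈ A) :
    ∃ B ∈ faces, B ≠ A ∧ u ∈ B ∧ v ∈ B := by
  have h2 := h.edge_two_faces {u, v} (Finset.card_pair huv) ⟨A, hA, by grind⟩
  have hm : A ∈ faces.filter fun F => ({u, v} : Finset V) ⊆ F := by
    simp only [Finset.mem_filter]
    exact ⟨hA, by grind⟩
  obtain ⟨B, hB, hne⟩ := Finset.exists_mem_ne (by rw [h2]; norm_num) A
  simp only [Finset.mem_filter] at hB
  exact ⟨B, hB.1, hne, by grind, by grind⟩

lemma face_eq [DecidableEq V] {F : Finset V} (hF : F.card = 3) {x y z : V} (hx : x ∈ F)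
    (hy : y ∈ F) (hz : z ∈ F) (hxy : x ≠ y) (hxz : x ≠ z) (hyz : y ≠ z) : F = {x, y, z} := by
  symm
  apply Finset.eq_of_subset_of_card_le
  · grind
  · rw [hF, Finset.card_eq_three.mpr ⟨x, y, z, hxy, hxz, hyz, rfl⟩]

lemma face_third [DecidableEq V] {F : Finset V} (hF : F.card = 3) {x y : V} (hx : x ∈ F)
    (hy : y ∈ F) (hxy : x ≠ y) : ∃ z, z ≠ x ∧ z ≠ y ∧ F = {x, y, z} := by
  have : ∃ z ∈ F, z ∉ ({x, y} : Finset V) := by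
    apply Finset.exists_mem_notMem_of_card_lt_card
    rw [hF, Finset.card_pair hxy]; norm_num
  obtain ⟨z, hz, hz'⟩ := this
  simp only [Finset.mem_insert, Finset.mem_singleton, not_or] at hz'
  exact ⟨z, hz'.1, hz'.2, face_eq hF hx hy hz hxy (Ne.symm hz'.1) (Ne.symm hz'.2)⟩

lemma face_two [DecidableEq V] {F : Finset V} (hF : F.card = 3) {x : V} (hx : x ∈ F) :
    ∃ y z, y ≠ x ∧ z ≠ x ∧ y ≠ z ∧ F = {x, y, z} := by
  obtain ⟨y, hy, hne⟩ := Finset.exists_mem_ne (by rw [hF]; norm_num) x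
  obtain ⟨z, h1, h2, h3⟩ := face_third hF hx hy hne.symm
  exact ⟨y, z, hne, h1, h2.symm, h3⟩

lemma mem_edgeSet' [DecidableEq V] {faces : Finset (Finset V)} {e : Finset V} :
    e ∈ edgeSet faces ↔ e.card = 2 ∧ ∃ F ∈ faces, e ⊆ F := by
  unfold edgeSet vertexSet
  simp only [Finset.mem_filter, Finset.mem_powersetCard]
  constructor
  · rintro ⟨⟨_, h1⟩, h2⟩; exact ⟨h1, h2⟩
  · rintro ⟨h1, F, hF, h2⟩
    refine ⟨⟨fun x hx => ?_, h1⟩, F, hF, h2⟩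
    exact Finset.mem_biUnion.mpr ⟨F, hF, h2 hx⟩

lemma IsTriangulation.count [DecidableEq V] {faces : Finset (Finset V)}
    (h : IsTriangulation faces) : 3 * faces.card = 2 * (edgeSet faces).card := by
  have := Finset.sum_card_bipartiteAbove_eq_sum_card_bipartiteBelow
    (s := faces) (t := edgeSet faces) (fun F e => e ⊆ F)
  have h1 : ∀ F ∈ faces, ((edgeSet faces).bipartiteAbove (fun F e => e ⊆ F) F).card = 3 := by
    intro F hF
    have : (edgeSet faces).bipartiteAbove (fun F e => e ⊆ F) F = F.powersetCard 2 := by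
      ext e
      simp only [Finset.bipartiteAbove, Finset.mem_filter, mem_edgeSet', Finset.mem_powersetCard]
      constructor
      · rintro ⟨⟨h1, _⟩, h2⟩; exact ⟨h2, h1⟩
      · rintro ⟨h1, h2⟩; exact ⟨⟨h2, F, hF, h1⟩, h1⟩
    rw [this, Finset.card_powersetCard, h.card_three F hF]; rfl
  have h2 : ∀ e ∈ edgeSet faces,
      (faces.bipartiteBelow (fun F e => e ⊆ F) e).card = 2 := by
    intro e he
    rw [mem_edgeSet'] at he
    have := h.edge_two_faces e he.1 he.2
    simp only [Finset.bipartiteBelow]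
    convert this
  rw [Finset.sum_congr rfl h1, Finset.sum_congr rfl h2] at this
  simp only [Finset.sum_const, smul_eq_mul] at this
  omega

/-- An edge with a common neighbour not spanning a face is not contractible. -/
lemma not_contract [DecidableEq V] {faces : Finset (Finset V)} (h : IsTriangulation faces)
    {a c x : V} (hac : a ≠ c) (hxa : x ≠ a) (hxc : x ≠ c)
    {F H : Finset V} (hF : F ∈ faces) (hH : H ∈ faces) (xF : x ∈ F) (aF : a ∈ F)
    (xH : x ∈ H) (cH : c ∈ H) (hn : ({a, c, x} : Finset V) ∉ faces)
    (hc : IsTriangulation (contract faces a c)) : False := by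
  have key : ∀ K ∈ faces, x ∈ K → a ∈ K → c ∈ K → False := by
    intro K hK h1 h2 h3
    exact hn (face_eq (h.card_three K hK) h2 h3 h1 hac hxa.symm hxc.symm ▸ hK)
  -- no two faces become identified
  have inj : ∀ K ∈ faces, ∀ L ∈ faces, x ∈ K → a ∈ K → x ∈ L → c ∈ L →
      K.image (rho a c) = L.image (rho a c) → False := by
    intro K hK L hL xK aK xL cL heq
    obtain ⟨p, hpx, hpa, hKe⟩ := face_third (h.card_three K hK) xK aK hxa
    have cK : c ∉ K := fun h' => key K hK xK aK h'
    have aL : a ∉ L := fun h' => key L hL xL h' cL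
    have pK : p ∈ K := by grind
    have hpc : p ≠ c := by grind
    have pL : p ∈ L := by
      have : p ∈ L.image (rho a c) := by
        rw [← heq, mem_img hac]; left; exact ⟨hpc, pK⟩
      rw [mem_img hac] at this
      grind
    obtain ⟨B, hB, hBne, xB, pB⟩ := hc.other (u := x) (v := p) hpx.symm
      (A := K.image (rho a c)) (mem_contract'.mpr ⟨K, hK, by grind, rfl⟩)
      (by rw [mem_img hac]; grind) (by rw [mem_img hac]; grind)
    obtain ⟨M, hM, hM', rfl⟩ := mem_contract'.mp hB
    rw [mem_img hac] at xB pB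
    have := h.two_eq (u := x) (v := p) hpx.symm hK hL hM (by grind) xK pK xL pL
      (by grind) (by grind)
    rcases this with rfl | rfl
    · exact hBne rfl
    · exact hBne heq.symm
  obtain ⟨F', hF', hne, xF', aF'⟩ := h.other hxa hF xF aF
  have inA : ∀ K ∈ faces, x ∈ K → a ∈ K → K.image (rho a c) ∈ contract faces a c :=
    fun K hK h1 h2 => mem_contract'.mpr ⟨K, hK, fun h' => key K hK h1 h2 h'.2, rfl⟩
  have inC : H.image (rho a c) ∈ contract faces a c :=
    mem_contract'.mpr ⟨H, hH, fun h' => key H hH xH h'.1 h'.2, rfl⟩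
  have hFF : F.image (rho a c) ≠ F'.image (rho a c) := by
    intro heq
    apply hne
    ext z
    have h1 := mem_img hac F z
    have h2 := mem_img hac F' z
    rw [heq] at h1
    have h3 := key F hF xF aF
    have h4 := key F' hF' xF' aF'
    grind
  have := hc.two_eq hxa (inA F hF xF aF) (inA F' hF' xF' aF') inC hFF
    (by rw [mem_img hac]; grind) (by rw [mem_img hac]; grind) (by rw [mem_img hac]; grind)
    (by rw [mem_img hac]; grind) (by rw [mem_img hac]; grind) (by rw [mem_img hac]; grind)
  rcases this with h' | h'
  · exact inj F hF H hH xF aF xH cH h'.symm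
  · exact inj F' hF' H hH xF' aF' xH cH h'.symm

/-- The local configuration around an edge `ac` lying in exactly two 3-cycles. -/
structure Cfg [DecidableEq V] (faces : Finset (Finset V)) (a c b d : V) : Prop where
  tri : IsTriangulation faces
  ac : a ≠ c
  ab : a ≠ b
  ad : a ≠ d
  cb : c ≠ b
  cd : c ≠ d
  bd : b ≠ d
  facb : ({a, c, b} : Finset V) ∈ faces
  facd : ({a, c, d} : Finset V) ∈ faces
  com : ∀ x : V, ∀ F ∈ faces, ∀ H ∈ faces, x ∈ F → a ∈ F → x ∈ H → c ∈ H → x ≠ a → x ≠ c →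
    x = b ∨ x = d
  nk4 : ¬ ((vertexSet faces).card = 4 ∧ eulerChar faces = 2)

lemma Cfg.symm [DecidableEq V] {faces : Finset (Finset V)} {a c b d : V}
    (g : Cfg faces a c b d) : Cfg faces c a b d where
  tri := g.tri
  ac := g.ac.symm
  ab := g.cb
  ad := g.cd
  cb := g.ab
  cd := g.ad
  bd := g.bd
  facb := by rw [Finset.insert_comm]; exact g.facb
  facd := by rw [Finset.insert_comm]; exact g.facd
  com := fun x F hF H hH h1 h2 h3 h4 h5 h6 => g.com x H hH F hF h3 h4 h1 h2 h6 h5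
  nk4 := g.nk4

lemma Cfg.swap [DecidableEq V] {faces : Finset (Finset V)} {a c b d : V}
    (g : Cfg faces a c b d) : Cfg faces a c d b where
  tri := g.tri
  ac := g.ac
  ab := g.ad
  ad := g.ab
  cb := g.cd
  cd := g.cb
  bd := g.bd.symm
  facb := g.facd
  facd := g.facb
  com := fun x F hF H hH h1 h2 h3 h4 h5 h6 => (g.com x F hF H hH h1 h2 h3 h4 h5 h6).symm
  nk4 := g.nk4

lemma Cfg.ne [DecidableEq V] {faces : Finset (Finset V)} {a c b d : V}
    (g : Cfg faces a c b d) : ({a, c, b} : Finset V) ≠ {a, c, d} := by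
  intro h
  have h1 : b ∈ ({a, c, d} : Finset V) := by rw [← h]; simp
  have := g.ab; have := g.cb; have := g.bd
  grind

lemma Cfg.both [DecidableEq V] {faces : Finset (Finset V)} {a c b d : V}
    (g : Cfg faces a c b d) {K : Finset V} (hK : K ∈ faces) (aK : a ∈ K) (cK : c ∈ K) :
    K = {a, c, b} ∨ K = {a, c, d} :=
  g.tri.two_eq g.ac g.facb g.facd hK g.ne (by simp) (by simp) (by simp) (by simp) aK cK

/-- The unique face other than `acb` through the edge `ab`. -/
lemma Cfg.side [DecidableEq V] {faces : Finset (Finset V)} {a c b d : V}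
    (g : Cfg faces a c b d) : ∃ P ∈ faces, a ∈ P ∧ b ∈ P ∧ c ∉ P ∧
      ∀ K ∈ faces, a ∈ K → b ∈ K → c ∉ K → K = P := by
  obtain ⟨P, hP, hne, aP, bP⟩ := g.tri.other g.ab g.facb (by simp) (by simp)
  refine ⟨P, hP, aP, bP, ?_, ?_⟩
  · intro cP
    exact hne (face_eq (g.tri.card_three P hP) aP cP bP g.ac g.ab g.cb)
  · intro K hK aK bK cK
    rcases g.tri.two_eq g.ab g.facb hP hK hne.symm (by simp) (by simp) aP bP aK bK with h | h
    · subst h; simp at cK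
    · exact h

lemma inter_two [DecidableEq V] {A B : Finset V} (h : 2 ≤ (A ∩ B).card) :
    ∃ u v, u ≠ v ∧ u ∈ A ∧ v ∈ A ∧ u ∈ B ∧ v ∈ B := by
  obtain ⟨u, hu, v, hv, hne⟩ := Finset.one_lt_card.mp h
  simp only [Finset.mem_inter] at hu hv
  exact ⟨u, v, hne, hu.1, hv.1, hu.2, hv.2⟩

lemma two_le_inter [DecidableEq V] {A B : Finset V} {u v : V} (huv : u ≠ v) (uA : u ∈ A)
    (vA : v ∈ A) (uB : u ∈ B) (vB : v ∈ B) : 2 ≤ (A ∩ B).card := by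
  apply Finset.one_lt_card.mpr
  exact ⟨u, by simp [uA, uB], v, by simp [vA, vB], huv⟩

set_option maxHeartbeats 1000000 in
lemma Cfg.no_tetra [DecidableEq V] {faces : Finset (Finset V)} {a c b d : V}
    (g : Cfg faces a c b d) (h1 : ({a, b, d} : Finset V) ∈ faces)
    (h2 : ({c, b, d} : Finset V) ∈ faces) : False := by
  have ac := g.ac
  have ab := g.ab
  have ad := g.ad
  have cb := g.cb
  have cd := g.cd
  have bd := g.bd
  set S : Finset V := {a, c, b, d} with hS
  have hScard : S.card = 4 := by
    rw [hS, Finset.card_insert_of_notMem (by simp [ac, ab, ad]),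
      Finset.card_insert_of_notMem (by simp [cb, cd]), Finset.card_pair bd]
  have n1 : ({a, c, b} : Finset V) ≠ {a, c, d} := g.ne
  have n2 : ({a, c, b} : Finset V) ≠ {a, b, d} := by
    intro h; have : c ∈ ({a, b, d} : Finset V) := by rw [← h]; simp
    grind
  have n3 : ({a, c, b} : Finset V) ≠ {c, b, d} := by
    intro h; have : a ∈ ({c, b, d} : Finset V) := by rw [← h]; simp
    grind
  have n4 : ({a, c, d} : Finset V) ≠ {a, b, d} := by
    intro h; have : c ∈ ({a, b, d} : Finset V) := by rw [← h]; simp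
    grind
  have n5 : ({a, c, d} : Finset V) ≠ {c, b, d} := by
    intro h; have : a ∈ ({c, b, d} : Finset V) := by rw [← h]; simp
    grind
  have n6 : ({a, b, d} : Finset V) ≠ {c, b, d} := by
    intro h; have : a ∈ ({c, b, d} : Finset V) := by rw [← h]; simp
    grind
  have cl : ∀ H ∈ faces, ∀ u v, u ≠ v → u ∈ S → v ∈ S → u ∈ H → v ∈ H → H ⊆ S := by
    have e1 : ∀ H ∈ faces, a ∈ H → c ∈ H → H ⊆ S := fun H hH x y => by
      rcases g.tri.two_eq ac g.facb g.facd hH n1 (by simp) (by simp) (by simp) (by simp) x y with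
        h | h <;> rw [h] <;> grind
    have e2 : ∀ H ∈ faces, a ∈ H → b ∈ H → H ⊆ S := fun H hH x y => by
      rcases g.tri.two_eq ab g.facb h1 hH n2 (by simp) (by simp) (by simp) (by simp) x y with
        h | h <;> rw [h] <;> grind
    have e3 : ∀ H ∈ faces, a ∈ H → d ∈ H → H ⊆ S := fun H hH x y => by
      rcases g.tri.two_eq ad g.facd h1 hH n4 (by simp) (by simp) (by simp) (by simp) x y with
        h | h <;> rw [h] <;> grind
    have e4 : ∀ H ∈ faces, c ∈ H → b ∈ H → H ⊆ S := fun H hH x y => by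
      rcases g.tri.two_eq cb g.facb h2 hH n3 (by simp) (by simp) (by simp) (by simp) x y with
        h | h <;> rw [h] <;> grind
    have e5 : ∀ H ∈ faces, c ∈ H → d ∈ H → H ⊆ S := fun H hH x y => by
      rcases g.tri.two_eq cd g.facd h2 hH n5 (by simp) (by simp) (by simp) (by simp) x y with
        h | h <;> rw [h] <;> grind
    have e6 : ∀ H ∈ faces, b ∈ H → d ∈ H → H ⊆ S := fun H hH x y => by
      rcases g.tri.two_eq bd h1 h2 hH n6 (by simp) (by simp) (by simp) (by simp) x y with
        h | h <;> rw [h] <;> grind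
    intro H hH u v huv uS vS uH vH
    have e1 := e1 H hH
    have e2 := e2 H hH
    have e3 := e3 H hH
    have e4 := e4 H hH
    have e5 := e5 H hH
    have e6 := e6 H hH
    simp only [hS, Finset.mem_insert, Finset.mem_singleton] at uS vS
    rcases uS with rfl | rfl | rfl | rfl <;> rcases vS with rfl | rfl | rfl | rfl <;>
      first
        | exact absurd rfl huv
        | exact e1 uH vH
        | exact e1 vH uH
        | exact e2 uH vH
        | exact e2 vH uH
        | exact e3 uH vH
        | exact e3 vH uH
        | exact e4 uH vH
        | exact e4 vH uH
        | exact e5 uH vH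
        | exact e5 vH uH
        | exact e6 uH vH
        | exact e6 vH uH
  have sub : ∀ H ∈ faces, H ⊆ S := by
    intro H hH
    have := g.tri.connected _ g.facb H hH
    clear hH
    induction this with
    | refl => grind
    | tail hab hbc ih =>
      obtain ⟨_, hK, hc⟩ := hbc
      obtain ⟨u, v, huv, uA, vA, uB, vB⟩ := inter_two hc.ge
      exact cl _ hK u v huv (ih uA) (ih vA) uB vB
  have hcard : faces.card = 4 := by
    apply le_antisymm
    · have : faces ⊆ S.powersetCard 3 := fun H hH =>
        Finset.mem_powersetCard.mpr ⟨sub H hH, g.tri.card_three H hH⟩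
      have := Finset.card_le_card this
      rw [Finset.card_powersetCard, hScard] at this
      exact this
    · have : ({{a, c, b}, {a, c, d}, {a, b, d}, {c, b, d}} : Finset (Finset V)) ⊆ faces := by
        intro X hX
        simp only [Finset.mem_insert, Finset.mem_singleton] at hX
        rcases hX with rfl | rfl | rfl | rfl
        exacts [g.facb, g.facd, h1, h2]
      have := Finset.card_le_card this
      rwa [Finset.card_insert_of_notMem (by simp [n1, n2, n3]),
        Finset.card_insert_of_notMem (by simp [n4, n5]), Finset.card_pair n6] at this
  have hv : vertexSet faces = S := by
    ext x
    simp only [vertexSet, Finset.mem_biUnion, id]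
    constructor
    · rintro ⟨F, hF, hx⟩; exact sub F hF hx
    · intro hx
      simp only [hS, Finset.mem_insert, Finset.mem_singleton] at hx
      rcases hx with rfl | rfl | rfl | rfl
      · exact ⟨_, g.facb, by simp⟩
      · exact ⟨_, g.facb, by simp⟩
      · exact ⟨_, g.facb, by simp⟩
      · exact ⟨_, g.facd, by simp⟩
  have := g.tri.count
  apply g.nk4
  rw [eulerChar, hv, hScard]
  refine ⟨rfl, ?_⟩
  rw [hcard] at *
  omega

/-- Contraction does not identify faces. -/
lemma Cfg.inj [DecidableEq V] {faces : Finset (Finset V)} {a c b d : V}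
    (g : Cfg faces a c b d) {F H : Finset V} (hF : F ∈ faces) (hH : H ∈ faces)
    (hF' : ¬ (a ∈ F ∧ c ∈ F)) (hH' : ¬ (a ∈ H ∧ c ∈ H))
    (heq : F.image (rho a c) = H.image (rho a c)) : F = H := by
  have hac := g.ac
  have main : ∀ F ∈ faces, ∀ H ∈ faces, a ∈ F → c ∉ F → c ∈ H → a ∉ H →
      F.image (rho a c) = H.image (rho a c) → False := by
    intro F hF H hH aF cF cH aH heq
    obtain ⟨x, y, hxa, hya, hxy, hFe⟩ := face_two (g.tri.card_three F hF) aF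
    have hh : ∀ z ∈ F, z ≠ a → z ∈ H := by
      intro z hz hza
      have : z ∈ H.image (rho a c) := by rw [← heq, mem_img hac]; grind
      rw [mem_img hac] at this
      grind
    have xF : x ∈ F := by grind
    have yF : y ∈ F := by grind
    have h1 := g.com x F hF H hH xF aF (hh x xF hxa) cH hxa (by grind)
    have h2 := g.com y F hF H hH yF aF (hh y yF hya) cH hya (by grind)
    have bF : b ∈ F := by grind
    have dF : d ∈ F := by grind
    apply g.no_tetra
    · exact face_eq (g.tri.card_three F hF) aF bF dF g.ab g.ad g.bd ▸ hF
    · exact face_eq (g.tri.card_three H hH) cH (hh b bF g.ab.symm) (hh d dF g.ad.symm)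
        g.cb g.cd g.bd ▸ hH
  by_cases hcF : c ∈ F <;> by_cases hcH : c ∈ H
  · ext z
    have h1 := mem_img hac F z
    have h2 := mem_img hac H z
    rw [heq] at h1
    grind
  · exfalso
    have h1 := mem_img hac F a
    have h2 := mem_img hac H a
    rw [heq] at h1
    exact main H hH F hF (by grind) hcH hcF (by grind) heq.symm
  · exfalso
    have h1 := mem_img hac F a
    have h2 := mem_img hac H a
    rw [heq] at h1
    exact main F hF H hH (by grind) hcF hcH (by grind) heq
  · ext z
    have h1 := mem_img hac F z
    have h2 := mem_img hac H z
    rw [heq] at h1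
    grind

/-- Adjacency (or equality) of faces at `a` not containing `c`. -/
def ArcRel [DecidableEq V] (faces : Finset (Finset V)) (a c : V) (K L : Finset V) : Prop :=
  K ∈ faces ∧ L ∈ faces ∧ a ∈ K ∧ a ∈ L ∧ c ∉ K ∧ c ∉ L ∧ 2 ≤ (K ∩ L).card

lemma ArcRel.symm' [DecidableEq V] {faces : Finset (Finset V)} {a c : V} {K L : Finset V}
    (h : ArcRel faces a c K L) : ArcRel faces a c L K := by
  obtain ⟨h1, h2, h3, h4, h5, h6, h7⟩ := h
  exact ⟨h2, h1, h4, h3, h6, h5, by rwa [Finset.inter_comm]⟩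

/-- The faces at `a` avoiding `c` form an arc; its two ends are connected. -/
lemma Cfg.ends [DecidableEq V] {faces : Finset (Finset V)} {a c b d : V}
    (g : Cfg faces a c b d) {P Q : Finset V} (hP : P ∈ faces) (aP : a ∈ P) (bP : b ∈ P)
    (cP : c ∉ P) (hPu : ∀ K ∈ faces, a ∈ K → b ∈ K → c ∉ K → K = P)
    (hQu : ∀ K ∈ faces, a ∈ K → d ∈ K → c ∉ K → K = Q) :
    Relation.ReflTransGen (ArcRel faces a c) P Q := by
  by_contra hcon
  have hac := g.ac
  set S := faces.filter fun K =>
    a ∈ K ∧ c ∉ K ∧ Relation.ReflTransGen (ArcRel faces a c) P K with hSdef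
  have hS : ∀ K, K ∈ S ↔ K ∈ faces ∧ a ∈ K ∧ c ∉ K ∧
      Relation.ReflTransGen (ArcRel faces a c) P K := by
    intro K; rw [hSdef, Finset.mem_filter]
  set t := (vertexSet faces).erase a with ht
  have hcount := Finset.sum_card_bipartiteAbove_eq_sum_card_bipartiteBelow
    (s := S) (t := t) (fun K x => x ∈ K)
  have h1 : ∀ K ∈ S, (t.bipartiteAbove (fun K x => x ∈ K) K).card = 2 := by
    intro K hK
    rw [hS] at hK
    have : t.bipartiteAbove (fun K x => x ∈ K) K = K.erase a := by
      ext x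
      simp only [Finset.bipartiteAbove, Finset.mem_filter, ht, Finset.mem_erase, vertexSet,
        Finset.mem_biUnion, id]
      constructor
      · rintro ⟨⟨h1, _⟩, h2⟩; exact ⟨h1, h2⟩
      · rintro ⟨h1, h2⟩; exact ⟨⟨h1, K, hK.1, h2⟩, h2⟩
    rw [this, Finset.card_erase_of_mem hK.2.1, g.tri.card_three K hK.1]
  have hmem : ∀ x K, K ∈ S.bipartiteBelow (fun K x => x ∈ K) x ↔ K ∈ S ∧ x ∈ K := by
    intro x K; simp [Finset.bipartiteBelow]
  have hb : (S.bipartiteBelow (fun K x => x ∈ K) b).card = 1 := by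
    rw [Finset.card_eq_one]
    refine ⟨P, ?_⟩
    ext K
    rw [hmem, hS, Finset.mem_singleton]
    constructor
    · rintro ⟨⟨h1, h2, h3, _⟩, h4⟩; exact hPu K h1 h2 h4 h3
    · rintro rfl; exact ⟨⟨hP, aP, cP, .refl⟩, bP⟩
  have hx : ∀ x ∈ t.erase b, 2 ∣ (S.bipartiteBelow (fun K x => x ∈ K) x).card := by
    intro x hx
    simp only [ht, Finset.mem_erase] at hx
    obtain ⟨hxb, hxa, -⟩ := hx
    by_cases hne : (S.bipartiteBelow (fun K x => x ∈ K) x).Nonempty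
    · obtain ⟨A, hA⟩ := hne
      rw [hmem, hS] at hA
      obtain ⟨⟨hA, aA, cA, rA⟩, xA⟩ := hA
      have hxd : x ≠ d := by
        rintro rfl
        exact hcon (hQu A hA aA xA cA ▸ rA)
      obtain ⟨B, hB, hBA, aB, xB⟩ := g.tri.other (Ne.symm hxa) hA aA xA
      have cB : c ∉ B := by
        intro cB
        have := g.com x A hA B hB xA aA xB cB hxa (by grind)
        grind
      have rB : Relation.ReflTransGen (ArcRel faces a c) P B :=
        rA.tail ⟨hA, hB, aA, aB, cA, cB, two_le_inter (Ne.symm hxa) aA xA aB xB⟩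
      have : S.bipartiteBelow (fun K x => x ∈ K) x = {A, B} := by
        ext K
        rw [hmem, hS, Finset.mem_insert, Finset.mem_singleton]
        constructor
        · rintro ⟨⟨k1, k2, k3, k4⟩, k5⟩
          exact g.tri.two_eq (Ne.symm hxa) hA hB k1 hBA.symm aA xA aB xB k2 k5
        · rintro (rfl | rfl)
          · exact ⟨⟨hA, aA, cA, rA⟩, xA⟩
          · exact ⟨⟨hB, aB, cB, rB⟩, xB⟩
      rw [this, Finset.card_pair hBA.symm]
    · rw [Finset.not_nonempty_iff_eq_empty] at hne
      rw [hne]; simp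
  have hbt : b ∈ t := by
    simp only [ht, Finset.mem_erase, vertexSet, Finset.mem_biUnion, id]
    exact ⟨g.ab.symm, P, hP, bP⟩
  rw [Finset.sum_congr rfl h1, ← Finset.add_sum_erase t _ hbt, hb] at hcount
  have := Finset.dvd_sum hx
  simp only [Finset.sum_const, smul_eq_mul] at hcount
  omega

/-- The faces at `a` avoiding `c` are connected among themselves. -/
lemma Cfg.arc [DecidableEq V] {faces : Finset (Finset V)} {a c b d : V}
    (g : Cfg faces a c b d) : ∃ P ∈ faces, a ∈ P ∧ b ∈ P ∧ c ∉ P ∧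
      ∀ K ∈ faces, a ∈ K → c ∉ K → Relation.ReflTransGen (ArcRel faces a c) P K := by
  obtain ⟨P, hP, aP, bP, cP, hPu⟩ := g.side
  obtain ⟨Q, hQ, aQ, dQ, cQ, hQu⟩ := g.swap.side
  have hPQ := g.ends hP aP bP cP hPu hQu
  refine ⟨P, hP, aP, bP, cP, ?_⟩
  intro K hK aK
  have := g.tri.link_connected a _ g.facb K hK (by simp) aK
  clear hK aK
  induction this with
  | refl => intro h; simp at h
  | @tail H K hab hbc ih =>
    intro cK
    obtain ⟨hH, hK, haHK, hcard⟩ := hbc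
    rw [Finset.mem_inter] at haHK
    by_cases cH : c ∈ H
    · have : b ∈ K ∨ d ∈ K := by
        obtain ⟨u, v, huv, uA, vA, uB, vB⟩ := inter_two hcard.ge
        rcases g.both hH haHK.1 cH with rfl | rfl <;> grind
      rcases this with h' | h'
      · rw [hPu K hK haHK.2 h' cK]
      · rw [hQu K hK haHK.2 h' cK]; exact hPQ
    · exact (ih cH).tail ⟨hH, hK, haHK.1, haHK.2, cH, cK, hcard.ge⟩

lemma near [DecidableEq V] {faces : Finset (Finset V)} (h3 : ∀ F ∈ faces, F.card = 3)
    {v : V} {A B : Finset V} (hA : A ∈ faces) (hB : B ∈ faces) (vA : v ∈ A) (vB : v ∈ B)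
    (h : 2 ≤ (A ∩ B).card) : Relation.ReflTransGen (LinkAdj faces v) A B := by
  by_cases hAB : A = B
  · subst hAB; exact .refl
  · apply Relation.ReflTransGen.single
    refine ⟨hA, hB, by simp [vA, vB], ?_⟩
    by_contra hne
    have h4 : 3 ≤ (A ∩ B).card := by omega
    have e1 := Finset.eq_of_subset_of_card_le (Finset.inter_subset_left (s₁ := A) (s₂ := B))
      (by rw [h3 A hA]; exact h4)
    have e2 := Finset.eq_of_subset_of_card_le (Finset.inter_subset_right (s₁ := A) (s₂ := B))
      (by rw [h3 B hB]; exact h4)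
    exact hAB (e1.symm.trans e2)

lemma img_inter [DecidableEq V] {a c : V} {F H : Finset V} (hF : ¬ (a ∈ F ∧ c ∈ F))
    (h : 2 ≤ (F ∩ H).card) : 2 ≤ (F.image (rho a c) ∩ H.image (rho a c)).card := by
  obtain ⟨u, v, huv, uA, vA, uB, vB⟩ := inter_two h
  exact two_le_inter (fun h' => huv (rho_injOn hF u uA v vA h'))
    (Finset.mem_image_of_mem _ uA) (Finset.mem_image_of_mem _ vA)
    (Finset.mem_image_of_mem _ uB) (Finset.mem_image_of_mem _ vB)

lemma Cfg.com_face [DecidableEq V] {faces : Finset (Finset V)} {a c b d : V}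
    (g : Cfg faces a c b d) {x : V} {F H : Finset V} (hF : F ∈ faces) (hH : H ∈ faces)
    (xF : x ∈ F) (aF : a ∈ F) (xH : x ∈ H) (cH : c ∈ H) (hxa : x ≠ a) (hxc : x ≠ c) :
    ({a, c, x} : Finset V) ∈ faces := by
  rcases g.com x F hF H hH xF aF xH cH hxa hxc with rfl | rfl
  · exact g.facb
  · exact g.facd

lemma Cfg.edge_a [DecidableEq V] {faces : Finset (Finset V)} {a c b d : V}
    (g : Cfg faces a c b d) {x : V} (hxa : x ≠ a) (hxc : x ≠ c) {F : Finset V}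
    (hF : F ∈ faces) (aF : a ∈ F) (xF : x ∈ F) (cF : c ∉ F) :
    ∃ H ∈ faces, ¬ (a ∈ H ∧ c ∈ H) ∧ H ≠ F ∧ x ∈ H ∧ (a ∈ H ∨ c ∈ H) ∧
      ∀ K ∈ faces, ¬ (a ∈ K ∧ c ∈ K) → x ∈ K → (a ∈ K ∨ c ∈ K) → K = F ∨ K = H := by
  have hac := g.ac
  obtain ⟨B, hB, hBF, xB, aB⟩ := g.tri.other hxa hF xF aF
  by_cases cB : c ∈ B
  · obtain ⟨H, hH, hHB, xH, cH⟩ := g.tri.other hxc hB xB cB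
    have aH : a ∉ H := by
      intro aH
      apply hHB
      rw [face_eq (g.tri.card_three H hH) aH cH xH hac hxa.symm hxc.symm,
        face_eq (g.tri.card_three B hB) aB cB xB hac hxa.symm hxc.symm]
    refine ⟨H, hH, by tauto, by grind, xH, Or.inr cH, ?_⟩
    intro K hK hnK xK hK'
    rcases hK' with aK | cK
    · rcases g.tri.two_eq hxa hF hB hK hBF.symm xF aF xB aB xK aK with h | h
      · exact Or.inl h
      · subst h; exact absurd ⟨aK, cB⟩ hnK
    · rcases g.tri.two_eq hxc hB hH hK hHB.symm xB cB xH cH xK cK with h | h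
      · subst h; exact absurd ⟨aB, cK⟩ hnK
      · exact Or.inr h
  · refine ⟨B, hB, by tauto, hBF, xB, Or.inl aB, ?_⟩
    intro K hK hnK xK hK'
    rcases hK' with aK | cK
    · exact g.tri.two_eq hxa hF hB hK hBF.symm xF aF xB aB xK aK
    · exfalso
      have hf := g.com_face hF hK xF aF xK cK hxa hxc
      rcases g.tri.two_eq hxa hF hB hf hBF.symm xF aF xB aB (by simp) (by simp) with h | h
      · rw [← h] at cF; simp at cF
      · rw [← h] at cB; simp at cB

lemma Cfg.edge_a' [DecidableEq V] {faces : Finset (Finset V)} {a c b d : V}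
    (g : Cfg faces a c b d) {x : V} (hxa : x ≠ a) (hxc : x ≠ c) {F : Finset V}
    (hF : F ∈ faces) (hac : a ∈ F ∨ c ∈ F) (xF : x ∈ F) (hn : ¬ (a ∈ F ∧ c ∈ F)) :
    ∃ H ∈ faces, ¬ (a ∈ H ∧ c ∈ H) ∧ H ≠ F ∧ x ∈ H ∧ (a ∈ H ∨ c ∈ H) ∧
      ∀ K ∈ faces, ¬ (a ∈ K ∧ c ∈ K) → x ∈ K → (a ∈ K ∨ c ∈ K) → K = F ∨ K = H := by
  by_cases aF : a ∈ F
  · exact g.edge_a hxa hxc hF aF xF (by tauto)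
  · have cF : c ∈ F := by tauto
    obtain ⟨H, h1, h2, h3, h4, h5, h6⟩ := g.symm.edge_a hxc hxa hF cF xF aF
    exact ⟨H, h1, by tauto, h3, h4, by tauto, fun K k1 k2 k3 k4 => h6 K k1 (by tauto) k3 (by tauto)⟩

/-- Every edge of the contraction lies in exactly two faces. -/
lemma Cfg.edge [DecidableEq V] {faces : Finset (Finset V)} {a c b d : V}
    (g : Cfg faces a c b d) {u v : V} (huv : u ≠ v) {F : Finset V} (hF : F ∈ faces)
    (hn : ¬ (a ∈ F ∧ c ∈ F)) (hu : u ∈ F.image (rho a c)) (hv : v ∈ F.image (rho a c)) :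
    ∃ H ∈ faces, ¬ (a ∈ H ∧ c ∈ H) ∧ H ≠ F ∧ u ∈ H.image (rho a c) ∧ v ∈ H.image (rho a c) ∧
      ∀ K ∈ faces, ¬ (a ∈ K ∧ c ∈ K) → u ∈ K.image (rho a c) → v ∈ K.image (rho a c) →
        K = F ∨ K = H := by
  have hac := g.ac
  have main : ∀ x, x ≠ a → a ∈ F.image (rho a c) → x ∈ F.image (rho a c) →
      ∃ H ∈ faces, ¬ (a ∈ H ∧ c ∈ H) ∧ H ≠ F ∧ a ∈ H.image (rho a c) ∧ x ∈ H.image (rho a c) ∧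
      ∀ K ∈ faces, ¬ (a ∈ K ∧ c ∈ K) → a ∈ K.image (rho a c) → x ∈ K.image (rho a c) →
        K = F ∨ K = H := by
    intro x hxa h1 h2
    rw [mem_img hac] at h1 h2
    obtain ⟨H, k1, k2, k3, k4, k5, k6⟩ := g.edge_a' (x := x) hxa (by grind) hF (by grind)
      (by grind) hn
    refine ⟨H, k1, k2, k3, by rw [mem_img hac]; grind, by rw [mem_img hac]; grind, ?_⟩
    intro K hK hnK aK xK
    rw [mem_img hac] at aK xK
    exact k6 K hK hnK (by grind) (by grind)
  by_cases hua : u = a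
  · subst hua; exact main v huv.symm hu hv
  · by_cases hva : v = a
    · subst hva
      obtain ⟨H, k1, k2, k3, k4, k5, k6⟩ := main u huv hv hu
      exact ⟨H, k1, k2, k3, k5, k4, fun K r1 r2 r3 r4 => k6 K r1 r2 r4 r3⟩
    · rw [mem_img hac] at hu hv
      have uF : u ∈ F := by tauto
      have vF : v ∈ F := by tauto
      have huc : u ≠ c := by tauto
      have hvc : v ≠ c := by tauto
      obtain ⟨H, hH, hne, uH, vH⟩ := g.tri.other huv hF uF vF
      refine ⟨H, hH, ?_, hne, by rw [mem_img hac]; tauto, by rw [mem_img hac]; tauto, ?_⟩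
      · rintro ⟨aH, cH⟩
        have := face_eq (g.tri.card_three H hH) aH cH uH hac (Ne.symm hua) huc.symm
        rw [this] at vH
        grind
      · intro K hK hnK uK vK
        rw [mem_img hac] at uK vK
        exact g.tri.two_eq huv hF hH hK hne.symm uF vF uH vH (by tauto) (by tauto)

lemma Cfg.card3 [DecidableEq V] {faces : Finset (Finset V)} {a c b d : V}
    (g : Cfg faces a c b d) : ∀ A ∈ contract faces a c, A.card = 3 := by
  intro A hA
  obtain ⟨F, hF, hn, rfl⟩ := mem_contract'.mp hA
  rw [card_img hn, g.tri.card_three F hF]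

lemma c_not_mem [DecidableEq V] {a c : V} (hac : a ≠ c) (F : Finset V) :
    c ∉ F.image (rho a c) := by
  rw [mem_img hac]
  grind

/-- The link of the merged vertex is connected. -/
lemma Cfg.link_a [DecidableEq V] {faces : Finset (Finset V)} {a c b d : V}
    (g : Cfg faces a c b d) {F H : Finset V} (hF : F ∈ faces) (hH : H ∈ faces)
    (hnF : ¬ (a ∈ F ∧ c ∈ F)) (hnH : ¬ (a ∈ H ∧ c ∈ H)) (aF : a ∈ F ∨ c ∈ F)
    (aH : a ∈ H ∨ c ∈ H) :
    Relation.ReflTransGen (LinkAdj (contract faces a c) a) (F.image (rho a c))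
      (H.image (rho a c)) := by
  have hac := g.ac
  obtain ⟨P, hP, aP, bP, cP, arcP⟩ := g.arc
  obtain ⟨Q, hQ, cQ, bQ, aQ, arcQ⟩ := g.symm.arc
  have ma : ∀ K : Finset V, (a ∈ K ∨ c ∈ K) → a ∈ K.image (rho a c) := by
    intro K hK; rw [mem_img hac]; grind
  have mc : ∀ K ∈ faces, ¬ (a ∈ K ∧ c ∈ K) → K.image (rho a c) ∈ contract faces a c :=
    fun K hK hn => mem_contract'.mpr ⟨K, hK, hn, rfl⟩
  have hsymm : ∀ A B, LinkAdj (contract faces a c) a A B →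
      LinkAdj (contract faces a c) a B A := by
    rintro A B ⟨h1, h2, h3, h4⟩
    exact ⟨h2, h1, by rwa [Finset.inter_comm], by rwa [Finset.inter_comm]⟩
  have toP : ∀ K, Relation.ReflTransGen (ArcRel faces a c) P K →
      Relation.ReflTransGen (LinkAdj (contract faces a c) a) (P.image (rho a c))
      (K.image (rho a c)) := by
    intro K hK
    induction hK with
    | refl => exact .refl
    | tail h1 h2 ih =>
      obtain ⟨k1, k2, k3, k4, k5, k6, k7⟩ := h2
      exact ih.trans (near g.card3 (mc _ k1 (by tauto)) (mc _ k2 (by tauto))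
        (ma _ (Or.inl k3)) (ma _ (Or.inl k4)) (img_inter (by tauto) k7))
  have toQ : ∀ K, Relation.ReflTransGen (ArcRel faces c a) Q K →
      Relation.ReflTransGen (LinkAdj (contract faces a c) a) (Q.image (rho a c))
      (K.image (rho a c)) := by
    intro K hK
    induction hK with
    | refl => exact .refl
    | tail h1 h2 ih =>
      obtain ⟨k1, k2, k3, k4, k5, k6, k7⟩ := h2
      exact ih.trans (near g.card3 (mc _ k1 (by tauto)) (mc _ k2 (by tauto))
        (ma _ (Or.inr k3)) (ma _ (Or.inr k4)) (img_inter (by tauto) k7))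
  have hPQ : Relation.ReflTransGen (LinkAdj (contract faces a c) a) (P.image (rho a c))
      (Q.image (rho a c)) := by
    have hb : ∀ K : Finset V, b ∈ K → b ∈ K.image (rho a c) := by
      intro K hK; rw [mem_img hac]; exact Or.inl ⟨g.cb.symm, hK⟩
    exact near g.card3 (mc _ hP (by tauto)) (mc _ hQ (by tauto)) (ma _ (Or.inl aP))
      (ma _ (Or.inr cQ)) (two_le_inter g.ab (ma _ (Or.inl aP)) (hb _ bP) (ma _ (Or.inr cQ))
        (hb _ bQ))
  have all : ∀ K ∈ faces, ¬ (a ∈ K ∧ c ∈ K) → (a ∈ K ∨ c ∈ K) →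
      Relation.ReflTransGen (LinkAdj (contract faces a c) a) (P.image (rho a c))
      (K.image (rho a c)) := by
    intro K hK hn hor
    by_cases aK : a ∈ K
    · exact toP K (arcP K hK aK (by tauto))
    · exact hPQ.trans (toQ K (arcQ K hK (by tauto) aK))
  have symm' : ∀ A B, Relation.ReflTransGen (LinkAdj (contract faces a c) a) A B →
      Relation.ReflTransGen (LinkAdj (contract faces a c) a) B A := by
    intro A B h
    induction h with
    | refl => exact .refl
    | tail _ h2 ih => exact Relation.ReflTransGen.head (hsymm _ _ h2) ih
  exact (symm' _ _ (all F hF hnF aF)).trans (all H hH hnH aH)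

lemma Cfg.link_v [DecidableEq V] {faces : Finset (Finset V)} {a c b d : V}
    (g : Cfg faces a c b d) {v : V} (hva : v ≠ a) (hvc : v ≠ c) {F H : Finset V}
    (hF : F ∈ faces) (hH : H ∈ faces)
    (hnF : ¬ (a ∈ F ∧ c ∈ F)) (hnH : ¬ (a ∈ H ∧ c ∈ H)) (vF : v ∈ F) (vH : v ∈ H) :
    Relation.ReflTransGen (LinkAdj (contract faces a c) v) (F.image (rho a c))
      (H.image (rho a c)) := by
  have hac := g.ac
  have mv : ∀ K : Finset V, v ∈ K → v ∈ K.image (rho a c) := by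
    intro K hK; rw [mem_img hac]; exact Or.inl ⟨hvc, hK⟩
  have ma : ∀ K : Finset V, (a ∈ K ∨ c ∈ K) → a ∈ K.image (rho a c) := by
    intro K hK; rw [mem_img hac]; grind
  have mc : ∀ K ∈ faces, ¬ (a ∈ K ∧ c ∈ K) → K.image (rho a c) ∈ contract faces a c :=
    fun K hK hn => mem_contract'.mpr ⟨K, hK, hn, rfl⟩
  have path := g.tri.link_connected v F hF H hH vF vH
  have key : ∀ H', H' ∈ faces → ¬ (a ∈ H' ∧ c ∈ H') → v ∈ H' →
      (H' = H ∨ ((a ∈ H ∧ c ∈ H) ∧ (a ∈ H' ∨ c ∈ H'))) →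
      Relation.ReflTransGen (LinkAdj (contract faces a c) v) (F.image (rho a c))
        (H'.image (rho a c)) := by
    clear hnH vH hH
    induction path with
    | refl =>
      rintro H' hH' hn vH' (rfl | h)
      · exact .refl
      · exact absurd h.1 hnF
    | @tail K L _ hKL ih =>
      obtain ⟨hK, hL, hvKL, hcard⟩ := hKL
      rw [Finset.mem_inter] at hvKL
      obtain ⟨vK, vL⟩ := hvKL
      obtain ⟨w, hw, hwv⟩ := Finset.exists_mem_ne (by rw [hcard]; norm_num : 1 < (K ∩ L).card) v
      rw [Finset.mem_inter] at hw
      have hface : ∀ M ∈ faces, v ∈ M → a ∈ M → c ∈ M → M = {a, c, v} := fun M hM h1 h2 h3 =>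
        face_eq (g.tri.card_three M hM) h2 h3 h1 hac hva.symm hvc.symm
      rintro H' hH' hn vH' (rfl | ⟨⟨aL, cL⟩, hor⟩)
      · by_cases hnK : a ∈ K ∧ c ∈ K
        · apply ih H' hL hn vL
          right
          refine ⟨hnK, ?_⟩
          have := hface K hK vK hnK.1 hnK.2
          grind
        · exact (ih K hK hnK vK (Or.inl rfl)).trans
            (near g.card3 (mc _ hK hnK) (mc _ hL hn) (mv _ vK) (mv _ vL)
              (img_inter hnK hcard.ge))
      · by_cases hnK : a ∈ K ∧ c ∈ K
        · exact ih H' hH' hn vH' (Or.inr ⟨hnK, hor⟩)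
        · have hL' := hface L hL vL aL cL
          have aK : a ∈ K ∨ c ∈ K := by grind
          exact (ih K hK hnK vK (Or.inl rfl)).trans
            (near g.card3 (mc _ hK hnK) (mc _ hH' hn) (mv _ vK) (mv _ vH')
              (two_le_inter hva (mv _ vK) (ma _ aK) (mv _ vH') (ma _ hor)))
  exact key H hH hnH vH (Or.inl rfl)

lemma Cfg.conn [DecidableEq V] {faces : Finset (Finset V)} {a c b d : V}
    (g : Cfg faces a c b d) {F H : Finset V}
    (hF : F ∈ faces) (hH : H ∈ faces)
    (hnF : ¬ (a ∈ F ∧ c ∈ F)) (hnH : ¬ (a ∈ H ∧ c ∈ H)) :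
    Relation.ReflTransGen (FaceAdj (contract faces a c)) (F.image (rho a c))
      (H.image (rho a c)) := by
  have hac := g.ac
  have mc : ∀ K ∈ faces, ¬ (a ∈ K ∧ c ∈ K) → K.image (rho a c) ∈ contract faces a c :=
    fun K hK hn => mem_contract'.mpr ⟨K, hK, hn, rfl⟩
  have toF : ∀ v A B, Relation.ReflTransGen (LinkAdj (contract faces a c) v) A B →
      Relation.ReflTransGen (FaceAdj (contract faces a c)) A B := by
    intro v A B h
    induction h with
    | refl => exact .refl
    | tail _ h2 ih => exact ih.tail ⟨h2.1, h2.2.1, h2.2.2.2⟩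
  have path := g.tri.connected F hF H hH
  have key : ∀ H', H' ∈ faces → ¬ (a ∈ H' ∧ c ∈ H') →
      (H' = H ∨ ((a ∈ H ∧ c ∈ H) ∧ (a ∈ H' ∨ c ∈ H'))) →
      Relation.ReflTransGen (FaceAdj (contract faces a c)) (F.image (rho a c))
        (H'.image (rho a c)) := by
    clear hnH hH
    induction path with
    | refl =>
      rintro H' hH' hn (rfl | h)
      · exact .refl
      · exact absurd h.1 hnF
    | @tail K L _ hKL ih =>
      obtain ⟨hK, hL, hcard⟩ := hKL
      obtain ⟨u, v, huv, uK, vK, uL, vL⟩ := inter_two hcard.ge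
      have hface : ∀ M ∈ faces, a ∈ M → c ∈ M → u ∈ M → v ∈ M →
          u = a ∨ u = c ∨ v = a ∨ v = c := by
        intro M hM aM cM uM vM
        rcases g.both hM aM cM with rfl | rfl <;> grind
      rintro H' hH' hn (rfl | ⟨⟨aL, cL⟩, hor⟩)
      · by_cases hnK : a ∈ K ∧ c ∈ K
        · apply ih H' hL hn
          right
          refine ⟨hnK, ?_⟩
          have := hface K hK hnK.1 hnK.2 uK vK
          grind
        · refine (ih K hK hnK (Or.inl rfl)).trans (toF (rho a c u) _ _
            (near g.card3 (mc _ hK hnK) (mc _ hL hn) (Finset.mem_image_of_mem _ uK)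
              (Finset.mem_image_of_mem _ uL) (img_inter hnK hcard.ge)))
      · by_cases hnK : a ∈ K ∧ c ∈ K
        · exact ih H' hH' hn (Or.inr ⟨hnK, hor⟩)
        · have hL' := hface L hL aL cL uL vL
          have aK : a ∈ K ∨ c ∈ K := by grind
          exact (ih K hK hnK (Or.inl rfl)).trans
            (toF a _ _ (g.link_a hK hH' hnK hn aK hor))
  exact key H hH hnH (Or.inl rfl)

lemma Cfg.isTri [DecidableEq V] {faces : Finset (Finset V)} {a c b d : V}
    (g : Cfg faces a c b d) : IsTriangulation (contract faces a c) where
  nonempty := by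
    obtain ⟨P, hP, aP, bP, cP, -⟩ := g.side
    exact ⟨_, mem_contract'.mpr ⟨P, hP, by tauto, rfl⟩⟩
  card_three := g.card3
  edge_two_faces := by
    intro e he hex
    obtain ⟨A, hA, heA⟩ := hex
    obtain ⟨u, v, huv, rfl⟩ := Finset.card_eq_two.mp he
    obtain ⟨F, hF, hn, rfl⟩ := mem_contract'.mp hA
    obtain ⟨H, k1, k2, k3, k4, k5, k6⟩ := g.edge huv hF hn (heA (by simp)) (heA (by simp))
    rw [Finset.card_eq_two]
    refine ⟨F.image (rho a c), H.image (rho a c), fun h => k3 (g.inj hF k1 hn k2 h).symm, ?_⟩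
    ext X
    simp only [Finset.mem_filter, Finset.mem_insert, Finset.mem_singleton]
    constructor
    · rintro ⟨hX, hsub⟩
      obtain ⟨K, hK, hnK, rfl⟩ := mem_contract'.mp hX
      rcases k6 K hK hnK (hsub (by simp)) (hsub (by simp)) with rfl | rfl
      · exact Or.inl rfl
      · exact Or.inr rfl
    · rintro (rfl | rfl)
      · exact ⟨hA, heA⟩
      · refine ⟨mem_contract'.mpr ⟨H, k1, k2, rfl⟩, ?_⟩
        intro z hz
        simp only [Finset.mem_insert, Finset.mem_singleton] at hz
        rcases hz with rfl | rfl
        · exact k4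
        · exact k5
  link_connected := by
    intro v A hA B hB vA vB
    obtain ⟨F, hF, hnF, rfl⟩ := mem_contract'.mp hA
    obtain ⟨H, hH, hnH, rfl⟩ := mem_contract'.mp hB
    have hac := g.ac
    have hvc : v ≠ c := by rintro rfl; exact c_not_mem hac _ vA
    rw [mem_img hac] at vA vB
    by_cases hva : v = a
    · subst hva
      exact g.link_a hF hH hnF hnH (by tauto) (by tauto)
    · exact g.link_v hva hvc hF hH hnF hnH (by tauto) (by tauto)
  connected := by
    intro A hA B hB
    obtain ⟨F, hF, hnF, rfl⟩ := mem_contract'.mp hA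
    obtain ⟨H, hH, hnH, rfl⟩ := mem_contract'.mp hB
    exact g.conn hF hH hnF hnH

lemma Cfg.card_faces [DecidableEq V] {faces : Finset (Finset V)} {a c b d : V}
    (g : Cfg faces a c b d) : (contract faces a c).card + 2 = faces.card := by
  have h1 : (contract faces a c).card = (faces.filter fun F => ¬ (a ∈ F ∧ c ∈ F)).card := by
    apply Finset.card_image_of_injOn
    intro F hF H hH heq
    simp only [Finset.coe_filter, Set.mem_ofPred_eq] at hF hH
    exact g.inj hF.1 hH.1 hF.2 hH.2 heq
  have h2 : (faces.filter fun F => (a ∈ F ∧ c ∈ F)) = {{a, c, b}, {a, c, d}} := by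
    ext K
    simp only [Finset.mem_filter, Finset.mem_insert, Finset.mem_singleton]
    constructor
    · rintro ⟨h1, h2, h3⟩; exact g.both h1 h2 h3
    · rintro (rfl | rfl)
      · exact ⟨g.facb, by simp, by simp⟩
      · exact ⟨g.facd, by simp, by simp⟩
  have h3 := Finset.card_filter_add_card_filter_not (s := faces) (fun F => (a ∈ F ∧ c ∈ F))
  rw [h2, Finset.card_pair g.ne] at h3
  omega

lemma Cfg.card_verts [DecidableEq V] {faces : Finset (Finset V)} {a c b d : V}
    (g : Cfg faces a c b d) :
    (vertexSet (contract faces a c)).card + 1 = (vertexSet faces).card := by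
  have hac := g.ac
  have hc : c ∈ vertexSet faces := by
    simp only [vertexSet, Finset.mem_biUnion, id]
    exact ⟨_, g.facb, by simp⟩
  have : vertexSet (contract faces a c) = (vertexSet faces).erase c := by
    ext x
    simp only [vertexSet, Finset.mem_biUnion, id, Finset.mem_erase]
    constructor
    · rintro ⟨A, hA, hx⟩
      obtain ⟨F, hF, hnF, rfl⟩ := mem_contract'.mp hA
      refine ⟨by rintro rfl; exact c_not_mem hac _ hx, ?_⟩
      rw [mem_img hac] at hx
      rcases hx with hx | hx
      · exact ⟨F, hF, hx.2⟩
      · exact ⟨_, g.facb, by simp [hx.1]⟩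
    · rintro ⟨hxc, F, hF, xF⟩
      have good : ∀ K ∈ faces, ¬ (a ∈ K ∧ c ∈ K) → x ∈ K → ∃ A ∈ contract faces a c, x ∈ A := by
        intro K hK hn xK
        exact ⟨_, mem_contract'.mpr ⟨K, hK, hn, rfl⟩, by rw [mem_img hac]; exact Or.inl ⟨hxc, xK⟩⟩
      by_cases hn : a ∈ F ∧ c ∈ F
      · obtain ⟨P, hP, aP, bP, cP, -⟩ := g.side
        obtain ⟨Q, hQ, aQ, dQ, cQ, -⟩ := g.swap.side
        have : x = a ∨ x = b ∨ x = d := by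
          rcases g.both hF hn.1 hn.2 with rfl | rfl <;> grind
        rcases this with rfl | rfl | rfl
        · exact good P hP (by tauto) aP
        · exact good P hP (by tauto) bP
        · exact good Q hQ (by tauto) dQ
      · exact good F hF hn xF
  rw [this, Finset.card_erase_add_one hc]

lemma Cfg.euler [DecidableEq V] {faces : Finset (Finset V)} {a c b d : V}
    (g : Cfg faces a c b d) : eulerChar (contract faces a c) = eulerChar faces := by
  have h1 := g.card_faces
  have h2 := g.card_verts
  have h3 := g.tri.count
  have h4 := g.isTri.count
  unfold eulerChar
  omega

lemma cyc_out [DecidableEq V] {F : Finset V} {d : Finset (V × V)} (h : IsCyclicOrientation F d)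
    {x : V} (hx : x ∈ F) : ∃ y ∈ F, y ≠ x ∧ (x, y) ∈ d ∧ ∀ z, (x, z) ∈ d → z = y := by
  obtain ⟨p, hp⟩ := Finset.card_eq_one.mp (h.2.2 x hx).1
  have hp' : p ∈ d.filter fun p => p.1 = x := by rw [hp]; simp
  rw [Finset.mem_filter] at hp'
  obtain ⟨p1, p2⟩ := p
  obtain ⟨hpd, rfl⟩ := hp'
  have := h.2.1 _ hpd
  refine ⟨p2, this.2.1, this.2.2.symm, hpd, ?_⟩
  intro z hz
  have : (p1, z) ∈ d.filter fun p => p.1 = p1 := by rw [Finset.mem_filter]; exact ⟨hz, rfl⟩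
  rw [hp, Finset.mem_singleton] at this
  exact (Prod.ext_iff.mp this).2

lemma cyc_in [DecidableEq V] {F : Finset V} {d : Finset (V × V)} (h : IsCyclicOrientation F d)
    {x : V} (hx : x ∈ F) : ∃ y ∈ F, y ≠ x ∧ (y, x) ∈ d ∧ ∀ z, (z, x) ∈ d → z = y := by
  obtain ⟨p, hp⟩ := Finset.card_eq_one.mp (h.2.2 x hx).2
  have hp' : p ∈ d.filter fun p => p.2 = x := by rw [hp]; simp
  rw [Finset.mem_filter] at hp'
  obtain ⟨p1, p2⟩ := p
  obtain ⟨hpd, rfl⟩ := hp'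
  have := h.2.1 _ hpd
  refine ⟨p1, this.1, this.2.2, hpd, ?_⟩
  intro z hz
  have : (z, p2) ∈ d.filter fun p => p.2 = p2 := by rw [Finset.mem_filter]; exact ⟨hz, rfl⟩
  rw [hp, Finset.mem_singleton] at this
  exact (Prod.ext_iff.mp this).1

lemma cyc_form [DecidableEq V] {F : Finset V} {d : Finset (V × V)} (hF : F.card = 3)
    (h : IsCyclicOrientation F d) {x : V} (hx : x ∈ F) :
    ∃ y z, x ≠ y ∧ x ≠ z ∧ y ≠ z ∧ F = {x, y, z} ∧ d = {(x, y), (y, z), (z, x)} := by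
  obtain ⟨y, yF, hyx, hxy, -⟩ := cyc_out h hx
  obtain ⟨z, hzx, hzy, hFe⟩ := face_third hF hx yF hyx.symm
  have zF : z ∈ F := by grind
  obtain ⟨u, uF, huy, hyu, -⟩ := cyc_out h yF
  obtain ⟨w, wF, hwz, hzw, -⟩ := cyc_out h zF
  obtain ⟨ix, -, -, -, hix⟩ := cyc_in h hx
  obtain ⟨iy, -, -, -, hiy⟩ := cyc_in h yF
  have hwy : w ≠ y := by
    rintro rfl
    exact hzx ((hiy z hzw).trans (hiy x hxy).symm)
  have hw : w = x := by grind
  subst hw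
  have hux : u ≠ w := by
    rintro rfl
    exact hzy ((hix z hzw).trans (hix y hyu).symm)
  have hu : u = z := by grind
  subst hu
  refine ⟨y, u, hyx.symm, hux.symm, huy.symm, hFe, ?_⟩
  symm
  apply Finset.eq_of_subset_of_card_le
  · grind
  · rw [h.1]
    apply le_of_eq
    symm
    apply Finset.card_eq_three.mpr
    exact ⟨(w, y), (y, u), (u, w), by grind, by grind, by grind, rfl⟩

lemma cyc_mk [DecidableEq V] {x y z : V} (hxy : x ≠ y) (hxz : x ≠ z) (hyz : y ≠ z) :
    IsCyclicOrientation ({x, y, z} : Finset V) {(x, y), (y, z), (z, x)} := by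
  refine ⟨?_, ?_, ?_⟩
  · apply Finset.card_eq_three.mpr
    exact ⟨(x, y), (y, z), (z, x), by grind, by grind, by grind, rfl⟩
  · intro p hp
    simp only [Finset.mem_insert, Finset.mem_singleton] at hp
    rcases hp with rfl | rfl | rfl <;> simp [hxy, hyz, hxz.symm]
  · intro w hw
    simp only [Finset.mem_insert, Finset.mem_singleton] at hw
    rcases hw with rfl | rfl | rfl <;>
      simp [Finset.filter_insert, Finset.filter_singleton, hxy, hyz, hxz, hxy.symm, hyz.symm,
        hxz.symm]

lemma cyc_or [DecidableEq V] {F : Finset V} {d : Finset (V × V)} (hF : F.card = 3)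
    (h : IsCyclicOrientation F d) {x y : V} (hx : x ∈ F) (hy : y ∈ F) (hxy : x ≠ y) :
    (x, y) ∈ d ↔ (y, x) ∉ d := by
  obtain ⟨u, v, h1, h2, h3, rfl, rfl⟩ := cyc_form hF h hx
  simp only [Finset.mem_insert, Finset.mem_singleton] at hy
  rcases hy with rfl | rfl | rfl
  · exact absurd rfl hxy
  · simp only [Finset.mem_insert, Finset.mem_singleton, Prod.mk.injEq]; grind
  · simp only [Finset.mem_insert, Finset.mem_singleton, Prod.mk.injEq]; grind

lemma cyc_image [DecidableEq V] {F : Finset V} {d : Finset (V × V)} (hF : F.card = 3)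
    (h : IsCyclicOrientation F d) (f : V → V) (hf : ∀ x ∈ F, ∀ y ∈ F, f x = f y → x = y) :
    IsCyclicOrientation (F.image f) (d.image (Prod.map f f)) := by
  obtain ⟨x, hx⟩ : F.Nonempty := Finset.card_pos.mp (by omega)
  obtain ⟨y, z, h1, h2, h3, rfl, rfl⟩ := cyc_form hF h hx
  simp only [Finset.image_insert, Finset.image_singleton, Prod.map_apply]
  exact cyc_mk (fun h' => h1 (hf _ (by simp) _ (by simp) h'))
    (fun h' => h2 (hf _ (by simp) _ (by simp) h')) (fun h' => h3 (hf _ (by simp) _ (by simp) h'))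

/-- Pull back an orientation along a map. -/
def pull [DecidableEq V] (f : V → V) (F : Finset V) (d : Finset (V × V)) : Finset (V × V) :=
  (F ×ˢ F).filter fun p => (f p.1, f p.2) ∈ d

lemma mem_pull [DecidableEq V] {f : V → V} {F : Finset V} {d : Finset (V × V)} {x y : V} :
    (x, y) ∈ pull f F d ↔ x ∈ F ∧ y ∈ F ∧ (f x, f y) ∈ d := by
  simp [pull, and_assoc]

lemma cyc_pull [DecidableEq V] {F : Finset V} {d : Finset (V × V)} (hF : F.card = 3)
    (f : V → V) (hf : ∀ x ∈ F, ∀ y ∈ F, f x = f y → x = y)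
    (h : IsCyclicOrientation (F.image f) d) : IsCyclicOrientation F (pull f F d) := by
  obtain ⟨x, hx⟩ : F.Nonempty := Finset.card_pos.mp (by omega)
  have hF' : (F.image f).card = 3 := by
    rw [Finset.card_image_of_injOn (fun x hx y hy h => hf x hx y hy h), hF]
  obtain ⟨y', z', h1, h2, h3, he, rfl⟩ := cyc_form hF' h (Finset.mem_image_of_mem f hx)
  have hy' : y' ∈ F.image f := by rw [he]; simp
  have hz' : z' ∈ F.image f := by rw [he]; simp
  obtain ⟨y, hy, rfl⟩ := Finset.mem_image.mp hy'
  obtain ⟨z, hz, rfl⟩ := Finset.mem_image.mp hz'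
  have hxy : x ≠ y := fun h => h1 (by rw [h])
  have hxz : x ≠ z := fun h => h2 (by rw [h])
  have hyz : y ≠ z := fun h => h3 (by rw [h])
  have hFe := face_eq hF hx hy hz hxy hxz hyz
  have : pull f F {(f x, f y), (f y, f z), (f z, f x)} = {(x, y), (y, z), (z, x)} := by
    ext ⟨p, q⟩
    rw [mem_pull]
    simp only [Finset.mem_insert, Finset.mem_singleton, Prod.mk.injEq]
    constructor
    · rintro ⟨hp, hq, ⟨k1, k2⟩ | ⟨k1, k2⟩ | ⟨k1, k2⟩⟩
      · exact Or.inl ⟨hf _ hp _ hx k1, hf _ hq _ hy k2⟩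
      · exact Or.inr (Or.inl ⟨hf _ hp _ hy k1, hf _ hq _ hz k2⟩)
      · exact Or.inr (Or.inr ⟨hf _ hp _ hz k1, hf _ hq _ hx k2⟩)
    · rintro (⟨rfl, rfl⟩ | ⟨rfl, rfl⟩ | ⟨rfl, rfl⟩) <;> simp [hx, hy, hz]
  rw [this, hFe]
  exact cyc_mk hxy hxz hyz

lemma Cfg.orient_fwd [DecidableEq V] {faces : Finset (Finset V)} {a c b d : V}
    (g : Cfg faces a c b d) (ho : Orientable faces) : Orientable (contract faces a c) := by
  obtain ⟨o, ho1, ho2⟩ := ho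
  have hac := g.ac
  choose! ψ hψ1 hψ2 hψ3 using
    (fun (A : Finset V) (hA : A ∈ contract faces a c) => mem_contract'.mp hA)
  -- the opposite face argument
  have opp : ∀ F ∈ faces, ∀ H ∈ faces, ¬ (a ∈ F ∧ c ∈ F) → ¬ (a ∈ H ∧ c ∈ H) → ∀ y,
      (a, y) ∈ o F → (c, y) ∈ o H → False := by
    intro F hF H hH hnF hnH y h1 h2
    have m1 := (ho1 F hF).2.1 _ h1
    have m2 := (ho1 H hH).2.1 _ h2
    simp only at m1 m2
    have hya : y ≠ a := m1.2.2.symm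
    have hyc : y ≠ c := m2.2.2.symm
    have hf := g.com_face hF hH m1.2.1 m1.1 m2.2.1 m2.1 hya hyc
    obtain ⟨z, hz, hzy, hz', -⟩ := cyc_in (ho1 _ hf) (x := y) (by simp)
    have : z = a ∨ z = c := by simp only [Finset.mem_insert, Finset.mem_singleton] at hz; tauto
    rcases this with rfl | rfl
    · exact ho2 F hF _ hf (by rintro rfl; simp at hnF) _ h1 hz'
    · exact ho2 H hH _ hf (by rintro rfl; simp at hnH) _ h2 hz'
  have opp' : ∀ F ∈ faces, ∀ H ∈ faces, ¬ (a ∈ F ∧ c ∈ F) → ¬ (a ∈ H ∧ c ∈ H) → ∀ y,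
      (y, a) ∈ o F → (y, c) ∈ o H → False := by
    intro F hF H hH hnF hnH y h1 h2
    have m1 := (ho1 F hF).2.1 _ h1
    have m2 := (ho1 H hH).2.1 _ h2
    simp only at m1 m2
    have hya : y ≠ a := m1.2.2
    have hyc : y ≠ c := m2.2.2
    have hf := g.com_face hF hH m1.1 m1.2.1 m2.1 m2.2.1 hya hyc
    obtain ⟨z, hz, hzy, hz', -⟩ := cyc_out (ho1 _ hf) (x := y) (by simp)
    have : z = a ∨ z = c := by simp only [Finset.mem_insert, Finset.mem_singleton] at hz; tauto
    rcases this with rfl | rfl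
    · exact ho2 F hF _ hf (by rintro rfl; simp at hnF) _ h1 hz'
    · exact ho2 H hH _ hf (by rintro rfl; simp at hnH) _ h2 hz'
  refine ⟨fun A => (o (ψ A)).image (Prod.map (rho a c) (rho a c)), ?_, ?_⟩
  · intro A hA
    have := cyc_image (g.tri.card_three _ (hψ1 A hA)) (ho1 _ (hψ1 A hA)) (rho a c)
      (rho_injOn (hψ2 A hA))
    rwa [hψ3 A hA] at this
  · intro A hA B hB hAB p hpA hpB
    have hne : ψ A ≠ ψ B := by
      intro h; apply hAB; rw [← hψ3 A hA, ← hψ3 B hB, h]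
    have hF := hψ1 A hA
    have hH := hψ1 B hB
    have hnF := hψ2 A hA
    have hnH := hψ2 B hB
    simp only [Finset.mem_image] at hpA hpB
    obtain ⟨⟨x, y⟩, hq, rfl⟩ := hpA
    obtain ⟨⟨x', y'⟩, hq', heq⟩ := hpB
    simp only [Prod.map_apply, Prod.mk.injEq] at heq
    obtain ⟨e1, e2⟩ := heq
    have m1 := (ho1 _ hF).2.1 _ hq
    have m2 := (ho1 _ hH).2.1 _ hq'
    simp only at m1 m2
    have c1 : x' = x ∨ (x' = a ∧ x = c) ∨ (x' = c ∧ x = a) := by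
      unfold rho at e1; split_ifs at e1 <;> grind
    have c2 : y' = y ∨ (y' = a ∧ y = c) ∨ (y' = c ∧ y = a) := by
      unfold rho at e2; split_ifs at e2 <;> grind
    rcases c1 with rfl | ⟨rfl, rfl⟩ | ⟨rfl, rfl⟩ <;> rcases c2 with rfl | ⟨rfl, rfl⟩ | ⟨rfl, rfl⟩
    · exact ho2 _ hF _ hH hne _ hq hq'
    · exact opp' _ hH _ hF hnH hnF _ hq' hq
    · exact opp' _ hF _ hH hnF hnH _ hq hq'
    · exact opp _ hH _ hF hnH hnF _ hq' hq
    · exact m1.2.2 rfl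
    · tauto
    · exact opp _ hF _ hH hnF hnH _ hq hq'
    · tauto
    · exact m1.2.2 rfl

/-- Going around the arc of faces at `a`, the two end edges are oriented oppositely. -/
lemma Cfg.turn [DecidableEq V] {faces : Finset (Finset V)} {a c b d : V}
    (g : Cfg faces a c b d) (T : Finset V → V → Prop)
    (h1 : ∀ K ∈ faces, a ∈ K → c ∉ K → ∃ y ∈ K, y ≠ a ∧ T K y)
    (h1' : ∀ K ∈ faces, a ∈ K → c ∉ K → ∃ y ∈ K, y ≠ a ∧ ¬ T K y)
    (h2 : ∀ K ∈ faces, ∀ L ∈ faces, a ∈ K → c ∉ K → a ∈ L → c ∉ L → K ≠ L →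
      ∀ y, y ∈ K → y ∈ L → y ≠ a → (T K y ↔ ¬ T L y))
    {P Q : Finset V} (hP : P ∈ faces) (aP : a ∈ P) (bP : b ∈ P) (cP : c ∉ P)
    (hQ : Q ∈ faces) (aQ : a ∈ Q) (dQ : d ∈ Q) (cQ : c ∉ Q)
    (hb : T P b) (hd : T Q d) : False := by
  obtain ⟨P', -, -, -, -, hPu⟩ := g.side
  obtain ⟨Q', -, -, -, -, hQu⟩ := g.swap.side
  have : Nonempty V := ⟨a⟩
  choose! o ho1 ho2 ho3 using h1
  choose! i hi1 hi2 hi3 using h1'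
  set S := faces.filter fun K => a ∈ K ∧ c ∉ K with hS
  have mS : ∀ K, K ∈ S ↔ K ∈ faces ∧ a ∈ K ∧ c ∉ K := by
    intro K; rw [hS, Finset.mem_filter]
  have co : (S.image o).card = S.card := by
    apply Finset.card_image_of_injOn
    intro K hK L hL heq
    obtain ⟨k1, k2, k3⟩ := (mS K).mp hK
    obtain ⟨l1, l2, l3⟩ := (mS L).mp hL
    by_contra hne
    have a1 := ho1 K k1 k2 k3
    have a2 := ho1 L l1 l2 l3
    have a3 := ho3 K k1 k2 k3
    have a4 := ho3 L l1 l2 l3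
    rw [← heq] at a2 a4
    exact (h2 K k1 L l1 k2 k3 l2 l3 hne _ a1 a2 (ho2 K k1 k2 k3)).mp a3 a4
  have ci : (S.image i).card = S.card := by
    apply Finset.card_image_of_injOn
    intro K hK L hL heq
    obtain ⟨k1, k2, k3⟩ := (mS K).mp hK
    obtain ⟨l1, l2, l3⟩ := (mS L).mp hL
    by_contra hne
    have a1 := hi1 K k1 k2 k3
    have a2 := hi1 L l1 l2 l3
    have a3 := hi3 K k1 k2 k3
    have a4 := hi3 L l1 l2 l3
    rw [← heq] at a2 a4
    exact a3 ((h2 K k1 L l1 k2 k3 l2 l3 hne _ a1 a2 (hi2 K k1 k2 k3)).mpr a4)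
  -- an out-edge can be recovered as a value of `o`
  have inj : ∀ L ∈ faces, a ∈ L → c ∉ L → o L ∈ S.image o := fun L l1 l2 l3 =>
    Finset.mem_image_of_mem _ ((mS L).mpr ⟨l1, l2, l3⟩)
  have cov : ∀ y, y ≠ a → (∃ K ∈ faces, a ∈ K ∧ c ∉ K ∧ y ∈ K ∧ ¬ T K y) →
      y ≠ b ∧ y ≠ d ∧ ∃ L ∈ faces, a ∈ L ∧ c ∉ L ∧ y ∈ L ∧ T L y := by
    rintro y hya ⟨K, k1, k2, k3, k4, k5⟩
    have hyb : y ≠ b := by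
      rintro rfl
      have := (hPu K k1 k2 k4 k3).trans (hPu P hP aP bP cP).symm
      subst this; exact k5 hb
    have hyd : y ≠ d := by
      rintro rfl
      have := (hQu K k1 k2 k4 k3).trans (hQu Q hQ aQ dQ cQ).symm
      subst this; exact k5 hd
    refine ⟨hyb, hyd, ?_⟩
    obtain ⟨L, l1, hLK, l2, l4⟩ := g.tri.other hya.symm k1 k2 k4
    have l3 : c ∉ L := by
      intro cL
      have := g.com y K k1 L l1 k4 k2 l4 cL hya (by grind)
      tauto
    refine ⟨L, l1, l2, l3, l4, ?_⟩
    exact (h2 L l1 K k1 l2 l3 k2 k3 hLK y l4 k4 hya).mpr k5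
  -- the set of all heads of out-edges
  set Out := (vertexSet faces).filter fun y =>
    y ≠ a ∧ ∃ L ∈ faces, a ∈ L ∧ c ∉ L ∧ y ∈ L ∧ T L y with hOut
  have mOut : ∀ y, y ∈ Out ↔ y ≠ a ∧ ∃ L ∈ faces, a ∈ L ∧ c ∉ L ∧ y ∈ L ∧ T L y := by
    intro y
    rw [hOut, Finset.mem_filter]
    constructor
    · exact fun h => h.2
    · rintro ⟨hya, L, l1, l2, l3, l4, l5⟩
      refine ⟨?_, hya, L, l1, l2, l3, l4, l5⟩
      simp only [vertexSet, Finset.mem_biUnion, id]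
      exact ⟨L, l1, l4⟩
  -- every face has exactly one out-edge
  have uniq : ∀ L ∈ faces, a ∈ L → c ∉ L → ∀ y ∈ L, y ≠ a → T L y → y = o L := by
    intro L l1 l2 l3 y l4 hya l5
    by_contra hne
    have e := face_eq (g.tri.card_three L l1) l2 l4 (ho1 L l1 l2 l3) hya.symm
      (ho2 L l1 l2 l3).symm hne
    have i1 := hi1 L l1 l2 l3
    have i2 := hi2 L l1 l2 l3
    have i3 := hi3 L l1 l2 l3
    have o3 := ho3 L l1 l2 l3
    have : i L = a ∨ i L = y ∨ i L = o L := by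
      have : i L ∈ ({a, y, o L} : Finset V) := e ▸ i1
      simpa only [Finset.mem_insert, Finset.mem_singleton] using this
    rcases this with h | h | h
    · exact i2 h
    · rw [h] at i3; exact i3 l5
    · rw [h] at i3; exact i3 o3
  have hOutEq : Out = S.image o := by
    ext y
    rw [mOut]
    constructor
    · rintro ⟨hya, L, l1, l2, l3, l4, l5⟩
      rw [uniq L l1 l2 l3 y l4 hya l5]
      exact inj L l1 l2 l3
    · intro hy
      obtain ⟨L, hL, rfl⟩ := Finset.mem_image.mp hy
      obtain ⟨l1, l2, l3⟩ := (mS L).mp hL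
      exact ⟨ho2 L l1 l2 l3, L, l1, l2, l3, ho1 L l1 l2 l3, ho3 L l1 l2 l3⟩
  have hsub : S.image i ⊆ Out.erase b := by
    intro y hy
    obtain ⟨L, hL, rfl⟩ := Finset.mem_image.mp hy
    obtain ⟨l1, l2, l3⟩ := (mS L).mp hL
    obtain ⟨c1, c2, c3⟩ := cov (i L) (hi2 L l1 l2 l3)
      ⟨L, l1, l2, l3, hi1 L l1 l2 l3, hi3 L l1 l2 l3⟩
    rw [Finset.mem_erase, mOut]
    exact ⟨c1, hi2 L l1 l2 l3, c3⟩
  have hbO : b ∈ Out := (mOut b).mpr ⟨g.ab.symm, P, hP, aP, cP, bP, hb⟩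
  have := Finset.card_le_card hsub
  rw [Finset.card_erase_of_mem hbO, hOutEq, ci, co] at this
  have : 0 < S.card := Finset.card_pos.mpr ⟨P, (mS P).mpr ⟨hP, aP, cP⟩⟩
  omega

lemma Cfg.orient_aux [DecidableEq V] {faces : Finset (Finset V)} {a c b d : V}
    (g : Cfg faces a c b d) (D : Finset V → Finset (V × V))
    (hD1 : ∀ F ∈ faces, ¬ (a ∈ F ∧ c ∈ F) → IsCyclicOrientation F (D F))
    (hD2 : ∀ F ∈ faces, ∀ H ∈ faces, ¬ (a ∈ F ∧ c ∈ F) → ¬ (a ∈ H ∧ c ∈ H) → F ≠ H →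
      ∀ p ∈ D F, p ∉ D H)
    (hab : ∀ K ∈ faces, ¬ (a ∈ K ∧ c ∈ K) → (b, a) ∉ D K)
    (hcb : ∀ K ∈ faces, ¬ (a ∈ K ∧ c ∈ K) → (c, b) ∉ D K)
    (had : ∀ K ∈ faces, ¬ (a ∈ K ∧ c ∈ K) → (a, d) ∉ D K)
    (hcd : ∀ K ∈ faces, ¬ (a ∈ K ∧ c ∈ K) → (d, c) ∉ D K) : Orientable faces := by
  have ac := g.ac
  have ab := g.ab
  have ad := g.ad
  have cb := g.cb
  have cd := g.cd
  have bd := g.bd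
  have hne := g.ne
  set o : Finset V → Finset (V × V) := fun F =>
    if F = {a, c, b} then {(a, c), (c, b), (b, a)}
    else if F = {a, c, d} then {(c, a), (a, d), (d, c)} else D F with ho
  have ob : o {a, c, b} = {(a, c), (c, b), (b, a)} := by simp [ho]
  have od : o {a, c, d} = {(c, a), (a, d), (d, c)} := by simp [ho, hne.symm]
  have oD : ∀ F ∈ faces, ¬ (a ∈ F ∧ c ∈ F) → o F = D F := by
    intro F hF hn
    have n1 : F ≠ {a, c, b} := by rintro rfl; simp at hn
    have n2 : F ≠ {a, c, d} := by rintro rfl; simp at hn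
    simp [ho, n1, n2]
  clear_value o
  have mixb : ∀ F ∈ faces, ¬ (a ∈ F ∧ c ∈ F) → ∀ p ∈ D F, p ∉ o {a, c, b} := by
    intro F hF hn p hp
    rw [ob]
    simp only [Finset.mem_insert, Finset.mem_singleton, not_or]
    refine ⟨?_, ?_, ?_⟩
    · rintro rfl
      have := (hD1 F hF hn).2.1 _ hp
      tauto
    · rintro rfl; exact hcb F hF hn hp
    · rintro rfl; exact hab F hF hn hp
  have mixd : ∀ F ∈ faces, ¬ (a ∈ F ∧ c ∈ F) → ∀ p ∈ D F, p ∉ o {a, c, d} := by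
    intro F hF hn p hp
    rw [od]
    simp only [Finset.mem_insert, Finset.mem_singleton, not_or]
    refine ⟨?_, ?_, ?_⟩
    · rintro rfl
      have := (hD1 F hF hn).2.1 _ hp
      tauto
    · rintro rfl; exact had F hF hn hp
    · rintro rfl; exact hcd F hF hn hp
  have bdis : ∀ p ∈ o {a, c, b}, p ∉ o {a, c, d} := by
    intro p hp
    rw [ob] at hp
    rw [od]
    simp only [Finset.mem_insert, Finset.mem_singleton] at hp ⊢
    rcases hp with rfl | rfl | rfl <;> simp only [Prod.mk.injEq] <;> grind
  refine ⟨o, ?_, ?_⟩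
  · intro F hF
    by_cases hn : a ∈ F ∧ c ∈ F
    · rcases g.both hF hn.1 hn.2 with rfl | rfl
      · rw [ob]; exact cyc_mk ac ab cb
      · rw [od, Finset.insert_comm]; exact cyc_mk ac.symm cd ad
    · rw [oD F hF hn]; exact hD1 F hF hn
  · intro F hF H hH hFH p hp hp'
    by_cases hn : a ∈ F ∧ c ∈ F <;> by_cases hn' : a ∈ H ∧ c ∈ H
    · rcases g.both hF hn.1 hn.2 with rfl | rfl <;> rcases g.both hH hn'.1 hn'.2 with rfl | rfl
      · exact hFH rfl
      · exact bdis p hp hp'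
      · exact bdis p hp' hp
      · exact hFH rfl
    · rw [oD H hH hn'] at hp'
      rcases g.both hF hn.1 hn.2 with rfl | rfl
      · exact mixb H hH hn' p hp' hp
      · exact mixd H hH hn' p hp' hp
    · rw [oD F hF hn] at hp
      rcases g.both hH hn'.1 hn'.2 with rfl | rfl
      · exact mixb F hF hn p hp hp'
      · exact mixd F hF hn p hp hp'
    · rw [oD F hF hn] at hp
      rw [oD H hH hn'] at hp'
      exact hD2 F hF H hH hn hn' hFH p hp hp'

lemma Cfg.orient_bwd [DecidableEq V] {faces : Finset (Finset V)} {a c b d : V}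
    (g : Cfg faces a c b d) (ho : Orientable (contract faces a c)) : Orientable faces := by
  obtain ⟨o, ho1, ho2⟩ := ho
  have hac := g.ac
  have mc : ∀ K ∈ faces, ¬ (a ∈ K ∧ c ∈ K) → K.image (rho a c) ∈ contract faces a c :=
    fun K hK hn => mem_contract'.mpr ⟨K, hK, hn, rfl⟩
  have ra : rho a c a = a := by simp [rho]
  have rc : rho a c c = a := by simp [rho]
  have rx : ∀ x, x ≠ c → rho a c x = x := by intro x hx; simp [rho, hx]
  have ho3 : ∀ F ∈ faces, ∀ H ∈ faces, ¬ (a ∈ F ∧ c ∈ F) → ¬ (a ∈ H ∧ c ∈ H) → F ≠ H →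
      ∀ p, p ∈ o (F.image (rho a c)) → p ∉ o (H.image (rho a c)) :=
    fun F hF H hH hn hn' hne p hp => ho2 _ (mc F hF hn) _ (mc H hH hn')
      (fun h => hne (g.inj hF hH hn hn' h)) p hp
  set D : Finset V → Finset (V × V) := fun F => pull (rho a c) F (o (F.image (rho a c))) with hD
  have mD : ∀ F x y, (x, y) ∈ D F ↔
      x ∈ F ∧ y ∈ F ∧ (rho a c x, rho a c y) ∈ o (F.image (rho a c)) := by
    intro F x y; rw [hD]; exact mem_pull
  have hD1 : ∀ F ∈ faces, ¬ (a ∈ F ∧ c ∈ F) → IsCyclicOrientation F (D F) :=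
    fun F hF hn => cyc_pull (g.tri.card_three F hF) _ (rho_injOn hn) (ho1 _ (mc F hF hn))
  clear_value D
  have hor : ∀ F ∈ faces, ¬ (a ∈ F ∧ c ∈ F) → ∀ x ∈ F, ∀ y ∈ F, x ≠ y →
      ((x, y) ∈ D F ↔ (y, x) ∉ D F) := fun F hF hn x hx y hy hxy =>
    cyc_or (g.tri.card_three F hF) (hD1 F hF hn) hx hy hxy
  have hD2 : ∀ F ∈ faces, ∀ H ∈ faces, ¬ (a ∈ F ∧ c ∈ F) → ¬ (a ∈ H ∧ c ∈ H) → F ≠ H →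
      ∀ p ∈ D F, p ∉ D H := by
    rintro F hF H hH hn hn' hne ⟨x, y⟩ hp hp'
    rw [mD] at hp hp'
    exact ho3 F hF H hH hn hn' hne _ hp.2.2 hp'.2.2
  have fin : ∀ b d, Cfg faces a c b d → ∀ P ∈ faces, a ∈ P → b ∈ P → c ∉ P → ∀ Q ∈ faces,
      a ∈ Q → d ∈ Q → c ∉ Q → (a, b) ∈ D P → (d, a) ∈ D Q → Orientable faces := by
    intro b d g P hP aP bP cP Q hQ aQ dQ cQ h1 h2
    obtain ⟨P', -, -, -, -, hPu⟩ := g.side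
    obtain ⟨Q', -, -, -, -, hQu⟩ := g.swap.side
    have nP : ¬ (a ∈ P ∧ c ∈ P) := by tauto
    have nQ : ¬ (a ∈ Q ∧ c ∈ Q) := by tauto
    have h1' := ((mD _ _ _).mp h1).2.2
    have h2' := ((mD _ _ _).mp h2).2.2
    rw [ra, rx b g.cb.symm] at h1'
    rw [ra, rx d g.cd.symm] at h2'
    apply g.orient_aux D hD1 hD2
    · intro K hK hn hm
      have m := (mD _ _ _).mp hm
      have : K = P := (hPu K hK m.2.1 m.1 (by tauto)).trans (hPu P hP aP bP cP).symm
      subst this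
      exact (hor K hK hn _ aP _ bP g.ab).mp h1 hm
    · intro K hK hn hm
      have m := (mD _ _ _).mp hm
      have m3 := m.2.2
      rw [rc, rx b g.cb.symm] at m3
      exact ho3 K hK P hP hn nP (by rintro rfl; exact cP m.1) _ m3 h1'
    · intro K hK hn hm
      have m := (mD _ _ _).mp hm
      have : K = Q := (hQu K hK m.1 m.2.1 (by tauto)).trans (hQu Q hQ aQ dQ cQ).symm
      subst this
      exact (hor K hK hn _ aQ _ dQ g.ad).mp hm h2
    · intro K hK hn hm
      have m := (mD _ _ _).mp hm
      have m3 := m.2.2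
      rw [rc, rx d g.cd.symm] at m3
      exact ho3 K hK Q hQ hn nQ (by rintro rfl; exact cQ m.2.1) _ m3 h2'
  obtain ⟨P, hP, aP, bP, cP, -⟩ := g.side
  obtain ⟨Q, hQ, aQ, dQ, cQ, -⟩ := g.swap.side
  have nP : ¬ (a ∈ P ∧ c ∈ P) := by tauto
  have nQ : ¬ (a ∈ Q ∧ c ∈ Q) := by tauto
  have t1 : ∀ K ∈ faces, a ∈ K → c ∉ K → ∃ y ∈ K, y ≠ a ∧ (a, y) ∈ D K := by
    intro K hK aK cK
    obtain ⟨y, yK, hya, hy, -⟩ := cyc_out (hD1 K hK (by tauto)) aK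
    exact ⟨y, yK, hya, hy⟩
  have t1' : ∀ K ∈ faces, a ∈ K → c ∉ K → ∃ y ∈ K, y ≠ a ∧ (a, y) ∉ D K := by
    intro K hK aK cK
    obtain ⟨y, yK, hya, hy, -⟩ := cyc_in (hD1 K hK (by tauto)) aK
    exact ⟨y, yK, hya, (hor K hK (by tauto) y yK a aK hya).mp hy⟩
  have t2 : ∀ K ∈ faces, ∀ L ∈ faces, a ∈ K → c ∉ K → a ∈ L → c ∉ L → K ≠ L →
      ∀ y, y ∈ K → y ∈ L → y ≠ a → ((a, y) ∈ D K ↔ ¬ (a, y) ∈ D L) := by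
    intro K hK L hL aK cK aL cL hne y yK yL hya
    constructor
    · intro h; exact hD2 K hK L hL (by tauto) (by tauto) hne _ h
    · intro h
      have h3 := (hor L hL (by tauto) y yL a aL hya).mpr h
      rw [hor K hK (by tauto) a aK y yK hya.symm]
      exact hD2 L hL K hK (by tauto) (by tauto) hne.symm _ h3
  by_cases hb : (a, b) ∈ D P
  · have hd : (a, d) ∉ D Q := fun hd =>
      g.turn (fun K y => (a, y) ∈ D K) t1 t1' t2 hP aP bP cP hQ aQ dQ cQ hb hd
    exact fin b d g P hP aP bP cP Q hQ aQ dQ cQ hb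
      ((hor Q hQ nQ d dQ a aQ g.ad.symm).mpr hd)
  · have hd : (a, d) ∈ D Q := by
      by_contra hd
      refine g.turn (fun K y => (a, y) ∉ D K) t1' ?_ ?_ hP aP bP cP hQ aQ dQ cQ hb hd
      · intro K hK aK cK
        obtain ⟨y, h1, h2, h3⟩ := t1 K hK aK cK
        exact ⟨y, h1, h2, not_not.mpr h3⟩
      · intro K hK L hL aK cK aL cL hne y yK yL hya
        exact not_congr (t2 K hK L hL aK cK aL cL hne y yK yL hya)
    exact fin d b g.swap Q hQ aQ dQ cQ P hP aP bP cP hd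
      ((hor P hP nP b bP a aP g.ab.symm).mpr hb)

/-- In a triangulation of a closed surface that is not K₄ on the sphere,
an edge is noncontractible iff it is contained in at least three 3-cycles. -/
theorem stmt2 [DecidableEq V] (faces : Finset (Finset V)) (h : IsTriangulation faces)
    (hK4 : ¬ ((vertexSet faces).card = 4 ∧ eulerChar faces = 2)) :
    ∀ e ∈ edgeSet faces,
      (¬ ContractibleEdge faces e ↔ 3 ≤ numTriCyclesOn faces e) := by

  intro e he
  have he' := mem_edgeSet'.mp he
  obtain ⟨a, c, hac, rfl⟩ := Finset.card_eq_two.mp he'.1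
  obtain ⟨F, hF, hsub⟩ := he'.2
  have aF : a ∈ F := hsub (by simp)
  have cF : c ∈ F := hsub (by simp)
  obtain ⟨H, hH, hHF, aH, cH⟩ := h.other hac hF aF cF
  obtain ⟨b, hba, hbc, rfl⟩ := face_third (h.card_three F hF) aF cF hac
  obtain ⟨d, hda, hdc, rfl⟩ := face_third (h.card_three H hH) aH cH hac
  have hbd : b ≠ d := by rintro rfl; exact hHF rfl
  -- membership in the set of common neighbours
  have mem : ∀ x, x ∈ ((vertexSet faces).filter fun x =>
      x ∉ ({a, c} : Finset V) ∧ ∀ y ∈ ({a, c} : Finset V), Adj faces x y) ↔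
      x ≠ a ∧ x ≠ c ∧ (∃ F ∈ faces, x ∈ F ∧ a ∈ F) ∧ (∃ F ∈ faces, x ∈ F ∧ c ∈ F) := by
    intro x
    simp only [Finset.mem_filter, Finset.mem_insert, Finset.mem_singleton, not_or, Adj,
      forall_eq_or_imp, forall_eq, Finset.insert_subset_iff, Finset.singleton_subset_iff,
      vertexSet, Finset.mem_biUnion, id]
    constructor
    · rintro ⟨-, ⟨h1, h2⟩, ⟨-, h3⟩, -, h4⟩
      exact ⟨h1, h2, h3, h4⟩
    · rintro ⟨h1, h2, ⟨F, h3, h4⟩, h5⟩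
      exact ⟨⟨F, h3, h4.1⟩, ⟨h1, h2⟩, ⟨h1, F, h3, h4⟩, h2, h5⟩
  unfold numTriCyclesOn
  set N := (vertexSet faces).filter fun x =>
      x ∉ ({a, c} : Finset V) ∧ ∀ y ∈ ({a, c} : Finset V), Adj faces x y with hN
  have bN : b ∈ N := (mem b).mpr
    ⟨hba, hbc, ⟨_, hF, by simp, by simp⟩, ⟨_, hF, by simp, by simp⟩⟩
  have dN : d ∈ N := (mem d).mpr
    ⟨hda, hdc, ⟨_, hH, by simp, by simp⟩, ⟨_, hH, by simp, by simp⟩⟩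
  constructor
  · intro hnc
    by_contra hlt
    apply hnc
    have hNe : ({b, d} : Finset V) = N := by
      apply Finset.eq_of_subset_of_card_le
      · intro x hx
        simp only [Finset.mem_insert, Finset.mem_singleton] at hx
        rcases hx with rfl | rfl
        · exact bN
        · exact dN
      · rw [Finset.card_pair hbd]; omega
    have g : Cfg faces a c b d :=
      { tri := h
        ac := hac
        ab := hba.symm
        ad := hda.symm
        cb := hbc.symm
        cd := hdc.symm
        bd := hbd
        facb := hF
        facd := hH
        com := by
          intro x A hA B hB h1 h2 h3 h4 h5 h6
          have : x ∈ N := (mem x).mpr ⟨h5, h6, ⟨A, hA, h1, h2⟩, ⟨B, hB, h3, h4⟩⟩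
          rw [← hNe] at this
          simpa using this
        nk4 := hK4 }
    exact ⟨a, c, rfl, he, g.isTri, g.euler, g.orient_bwd, g.orient_fwd⟩
  · intro h3 hcon
    obtain ⟨x, xN, hx⟩ : ∃ x ∈ N, x ∉ ({b, d} : Finset V) := by
      apply Finset.exists_mem_notMem_of_card_lt_card
      rw [Finset.card_pair hbd]; omega
    obtain ⟨hxa, hxc, ⟨A, hA, xA, aA⟩, ⟨B, hB, xB, cB⟩⟩ := (mem x).mp xN
    have hnf : ({a, c, x} : Finset V) ∉ faces := by
      intro hf
      have := h.two_eq hac hF hH hf hHF.symm (by simp) (by simp) (by simp) (by simp)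
        (by simp) (by simp)
      have hxm : x ∈ ({a, c, x} : Finset V) := by simp
      simp only [Finset.mem_insert, Finset.mem_singleton, not_or] at hx
      rcases this with h' | h' <;> rw [h'] at hxm <;> grind
    obtain ⟨a', c', heq, -, htri, -⟩ := hcon
    have h1 : a' ∈ ({a, c} : Finset V) := by rw [heq]; simp
    have h2 : c' ∈ ({a, c} : Finset V) := by rw [heq]; simp
    have h4 : a ∈ ({a', c'} : Finset V) := by rw [← heq]; simp
    have h5 : c ∈ ({a', c'} : Finset V) := by rw [← heq]; simp
    have : (a' = a ∧ c' = c) ∨ (a' = c ∧ c' = a) := by grind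
    rcases this with ⟨rfl, rfl⟩ | ⟨rfl, rfl⟩
    · exact not_contract h hac hxa hxc hA hB xA aA xB cB hnf htri
    · exact not_contract h hac.symm hxc hxa hB hA xB cB xA aA
        (by rw [Finset.insert_comm]; exact hnf) htri
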